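/- arXiv:1805.10791 — 3 statements merged into one kernel-verified Lean document; each statement's English description precedes it below -/
import Mathlib

section
/- Let d, s be integers with 1 ≤ s ≤ d and s² ≥ 4d, let ε > 0 and γ > 0. Then there exist a constant C > 0 depending only on γ and a Borel measurable function T : ℝ^d × ℝ^d → ℝ such that for every θ ∈ B_0(s) the following holds: if (y_{1,1},…,y_{1,d}, y_{2,1},…,y_{2,d}) are mutually independent real random variables with y_{j,i} distributed as N(θ_i, 2ε²) for j = 1,2 and i = 1,…,d, then E[(T(y_{1,·}, y_{2,·}) − N_γ(θ))²] ≤ C ( ε^{2γ} s² / (log(s²/d))^γ + (ε² s^{2/γ} / log(s²/d)) · ‖θ‖_γ^{2γ−2} · 1_{γ>1} ). -/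
open MeasureTheory ProbabilityTheory Real

lemma integral_Ioo_circle_eq_zero {h : ℂ → ℂ} (hh : Differentiable ℂ h) (h0 : h 0 = 0) (r : ℝ) :
    ∫ φ in Set.Ioo (-π) π, h (circleMap 0 r φ) = 0 := by
  have havg : Real.circleAverage h 0 r = 0 := by
    rw [DiffContOnCl.circleAverage hh.diffContOnCl, h0]
  have hper : Function.Periodic (fun φ => h (circleMap 0 r φ)) (2 * π) := fun φ => by
    simp only [periodic_circleMap 0 r φ]
  rw [Real.circleAverage_def, smul_eq_zero] at havg
  have hint := havg.resolve_left (by positivity)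
  rw [← integral_Ioc_eq_integral_Ioo, ← intervalIntegral.integral_of_le (by linarith [pi_pos])]
  have := hper.intervalIntegral_add_eq (-π) 0
  rwa [zero_add, hint, show -π + 2 * π = π by ring] at this

lemma integral_gaussian_density_mul_entire_eq_zero {h : ℂ → ℂ} (hh : Differentiable ℂ h)
    (h0 : h 0 = 0) (v : NNReal) :
    ∫ p : ℝ × ℝ, (gaussianPDFReal 0 v p.1 * gaussianPDFReal 0 v p.2) •
      h (p.1 + p.2 * Complex.I) = 0 := by
  rw [← integral_comp_polarCoord_symm]
  by_cases hi : IntegrableOn (fun p : ℝ × ℝ => p.1 •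
      ((gaussianPDFReal 0 v (polarCoord.symm p).1 * gaussianPDFReal 0 v (polarCoord.symm p).2) •
        h ((polarCoord.symm p).1 + (polarCoord.symm p).2 * Complex.I))) polarCoord.target
  swap
  · exact integral_undef hi
  rw [polarCoord_target, Measure.volume_eq_prod] at hi ⊢
  rw [setIntegral_prod _ hi]
  refine integral_eq_zero_of_ae (ae_of_all _ fun r => ?_)
  have key : ∀ φ : ℝ, r • ((gaussianPDFReal 0 v (polarCoord.symm (r, φ)).1 *
        gaussianPDFReal 0 v (polarCoord.symm (r, φ)).2) •
        h ((polarCoord.symm (r, φ)).1 + (polarCoord.symm (r, φ)).2 * Complex.I)) =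
      (r * ((√(2 * π * v))⁻¹ * (√(2 * π * v))⁻¹ * rexp (-r ^ 2 / (2 * v)))) •
        h (circleMap 0 r φ) := by
    intro φ
    have hz : ((polarCoord.symm (r, φ)).1 : ℂ) + (polarCoord.symm (r, φ)).2 * Complex.I =
        circleMap 0 r φ := by
      simp only [polarCoord_symm_apply, circleMap, Complex.exp_mul_I]
      push_cast
      ring
    have he : rexp (-(r * cos φ) ^ 2 / (2 * v)) * rexp (-(r * sin φ) ^ 2 / (2 * v)) =
        rexp (-r ^ 2 / (2 * v)) := by
      rw [← Real.exp_add, ← add_div]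
      congr 2
      linear_combination (-r ^ 2) * Real.sin_sq_add_cos_sq φ
    rw [hz, smul_smul, ← he]
    simp only [polarCoord_symm_apply, gaussianPDFReal, sub_zero]
    congr 1
    ring
  simp only [key]
  rw [integral_smul, integral_Ioo_circle_eq_zero hh h0, smul_zero]
  rfl

lemma integral_gaussian_prod_entire {f : ℂ → ℂ} (hf : Differentiable ℂ f) {v : NNReal}
    (hv : v ≠ 0)
    (hi : Integrable (fun p : ℝ × ℝ => f (p.1 + p.2 * Complex.I))
      ((gaussianReal 0 v).prod (gaussianReal 0 v))) :
    ∫ p : ℝ × ℝ, f (p.1 + p.2 * Complex.I) ∂(gaussianReal 0 v).prod (gaussianReal 0 v) = f 0 := by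
  have hd : (gaussianReal 0 v).prod (gaussianReal 0 v) =
      volume.withDensity fun p : ℝ × ℝ => gaussianPDF 0 v p.1 * gaussianPDF 0 v p.2 := by
    rw [gaussianReal_of_var_ne_zero _ hv, prod_withDensity (measurable_gaussianPDF 0 v)
      (measurable_gaussianPDF 0 v), Measure.volume_eq_prod]
  have hz : ∫ p : ℝ × ℝ, (f (p.1 + p.2 * Complex.I) - f 0)
      ∂(gaussianReal 0 v).prod (gaussianReal 0 v) = 0 := by
    rw [hd, integral_withDensity_eq_integral_toReal_smul
      (by have := measurable_gaussianPDF 0 v; fun_prop)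
      (ae_of_all _ fun _ => ENNReal.mul_lt_top gaussianPDF_lt_top gaussianPDF_lt_top)]
    simp only [ENNReal.toReal_mul, toReal_gaussianPDF]
    exact integral_gaussian_density_mul_entire_eq_zero (h := fun z => f z - f 0)
      (hf.sub_const _) (by simp) v
  rw [integral_sub hi (integrable_const _)] at hz
  simpa [sub_eq_zero] using hz

lemma norm_complex_sin_le (x y : ℝ) : ‖Complex.sin (x + y * Complex.I)‖ ≤ rexp |y| := by
  have h1 : ‖Complex.exp (-(x + y * Complex.I) * Complex.I)‖ ≤ rexp |y| := by
    rw [Complex.norm_exp, exp_le_exp]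
    simpa using le_abs_self y
  have h2 : ‖Complex.exp ((x + y * Complex.I) * Complex.I)‖ ≤ rexp |y| := by
    rw [Complex.norm_exp, exp_le_exp]
    simpa using neg_le_abs y
  rw [Complex.sin, norm_div, norm_mul, Complex.norm_I, mul_one, Complex.norm_ofNat]
  linarith [norm_sub_le (Complex.exp (-(x + y * Complex.I) * Complex.I))
    (Complex.exp ((x + y * Complex.I) * Complex.I))]

lemma differentiable_dslope_sin : Differentiable ℂ (dslope Complex.sin 0) := by
  rw [← differentiableOn_univ, Complex.differentiableOn_dslope Filter.univ_mem]
  exact Complex.differentiable_sin.differentiableOn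

lemma exists_sq_norm_dslope_sin_le : ∃ B : ℝ, 0 < B ∧ ∀ x y : ℝ,
    ‖dslope Complex.sin 0 (x + y * Complex.I)‖ ^ 2 ≤ B * rexp (2 * |y|) * (1 + x ^ 2)⁻¹ := by
  obtain ⟨M, hM⟩ := (isCompact_closedBall (0 : ℂ) 1).exists_bound_of_continuousOn
    differentiable_dslope_sin.continuous.continuousOn
  refine ⟨2 * (1 + M ^ 2), by positivity, fun x y => ?_⟩
  rw [← div_eq_mul_inv, le_div_iff₀ (by positivity)]
  have he : 1 ≤ rexp (2 * |y|) := one_le_exp (by positivity)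
  set z : ℂ := x + y * Complex.I with hz
  have hzn : ‖z‖ ^ 2 = x ^ 2 + y ^ 2 := by
    rw [Complex.sq_norm, hz, Complex.normSq_add_mul_I]
  rcases le_or_gt ‖z‖ 1 with h | h
  · have h1 := hM z (by simpa using h)
    have h2 : ‖dslope Complex.sin 0 z‖ ^ 2 ≤ M ^ 2 := by gcongr
    have h3 : 1 + x ^ 2 ≤ 2 := by nlinarith [norm_nonneg z, sq_nonneg y]
    calc _ ≤ M ^ 2 * 2 := by gcongr
      _ ≤ 2 * (1 + M ^ 2) * 1 := by linarith
      _ ≤ _ := by gcongr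
  · have hz0 : z ≠ 0 := norm_pos_iff.1 (by linarith)
    have hs : ‖Complex.sin z‖ ^ 2 ≤ rexp (2 * |y|) := by
      rw [two_mul, Real.exp_add, ← sq]
      gcongr
      exact norm_complex_sin_le x y
    have hx : 1 + x ^ 2 ≤ 2 * ‖z‖ ^ 2 := by nlinarith [sq_nonneg y]
    rw [dslope_of_ne _ hz0, slope_def_field, Complex.sin_zero, sub_zero, sub_zero, norm_div, div_pow,
      div_mul_eq_mul_div, div_le_iff₀ (by positivity)]
    calc _ ≤ rexp (2 * |y|) * (2 * ‖z‖ ^ 2) := by gcongr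
      _ ≤ (1 + M ^ 2) * (rexp (2 * |y|) * (2 * ‖z‖ ^ 2)) :=
        le_mul_of_one_le_left (by positivity) (by nlinarith [sq_nonneg M])
      _ = _ := by ring

lemma exists_dslope_sin_ofReal (x : ℝ) : ∃ r : ℝ, dslope Complex.sin 0 x = r := by
  rcases eq_or_ne x 0 with rfl | hx
  · exact ⟨1, by simp⟩
  · refine ⟨Real.sin x / x, ?_⟩
    rw [dslope_of_ne _ (by exact_mod_cast hx), slope_def_field]
    push_cast
    simp

/-- An entire function of exponential type, nonnegative on the real line and decaying there
at a prescribed polynomial rate. -/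
lemma exists_entire_kernel (n : ℕ) : ∃ K : ℂ → ℂ, Differentiable ℂ K ∧ (K 0).re = 1 ∧
    (∀ x : ℝ, 0 ≤ (K x).re) ∧ ∃ A c : ℝ, 0 < A ∧ 0 < c ∧ ∀ x y : ℝ,
      ‖K (x + y * Complex.I)‖ ≤ A * rexp (c * |y|) * ((1 + x ^ 2) ^ (n + 1))⁻¹ := by
  obtain ⟨B, hB, h⟩ := exists_sq_norm_dslope_sin_le
  refine ⟨fun z => (dslope Complex.sin 0 z ^ 2) ^ (n + 1),
    (differentiable_dslope_sin.pow 2).pow (n + 1), by simp, fun x => ?_,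
    B ^ (n + 1), 2 * (n + 1), by positivity, by positivity, fun x y => ?_⟩
  · obtain ⟨r, hr⟩ := exists_dslope_sin_ofReal x
    simp only [hr]
    norm_cast
    positivity
  · rw [norm_pow, norm_pow]
    calc _ ≤ (B * rexp (2 * |y|) * (1 + x ^ 2)⁻¹) ^ (n + 1) := by
          gcongr
          exact h x y
      _ = _ := by
          rw [mul_pow, mul_pow, ← Real.exp_nat_mul, inv_pow]
          push_cast
          ring_nf

lemma add_rpow_le_two_rpow_mul {p q r : ℝ} (hp : 0 ≤ p) (hq : 0 ≤ q) (hr : 0 ≤ r) :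
    (p + q) ^ r ≤ 2 ^ r * (p ^ r + q ^ r) := by
  have h1 := rpow_nonneg hp r
  have h2 := rpow_nonneg hq r
  have h3 : (0 : ℝ) ≤ 2 ^ r := by positivity
  rcases le_total p q with h | h
  · calc (p + q) ^ r ≤ (2 * q) ^ r := by gcongr; linarith
      _ = 2 ^ r * q ^ r := mul_rpow (by norm_num) hq
      _ ≤ _ := by gcongr; linarith
  · calc (p + q) ^ r ≤ (2 * p) ^ r := by gcongr; linarith
      _ = 2 ^ r * p ^ r := mul_rpow (by norm_num) hp
      _ ≤ _ := by gcongr; linarith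

lemma rpow_sub_rpow_le_mul {γ x y : ℝ} (hγ : 1 ≤ γ) (hy : 0 ≤ y) (hyx : y ≤ x) :
    x ^ γ - y ^ γ ≤ γ * x ^ (γ - 1) * (x - y) := by
  rcases hy.eq_or_lt with rfl | hy0
  · rcases hyx.eq_or_lt with rfl | hx
    · simp
    · rw [zero_rpow (by linarith), sub_zero, sub_zero, mul_assoc, ← rpow_add_one hx.ne',
        sub_add_cancel]
      exact le_mul_of_one_le_left (by positivity) hγ
  have hx : 0 < x := hy0.trans_le hyx
  have h := one_add_mul_self_le_rpow_one_add (s := y / x - 1)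
    (by linarith [div_nonneg hy hx.le]) hγ
  rw [add_sub_cancel, div_rpow hy hx.le, le_div_iff₀ (by positivity)] at h
  have hxx : x ^ γ = x ^ (γ - 1) * x := by rw [← rpow_add_one hx.ne', sub_add_cancel]
  have h2 : (1 + γ * (y / x - 1)) * x ^ γ = x ^ γ + γ * x ^ (γ - 1) * (y - x) := by
    rw [hxx]; field_simp
  linarith

lemma abs_abs_rpow_sub_le_of_le_one {γ : ℝ} (hγ : 0 ≤ γ) (hγ1 : γ ≤ 1) (a b : ℝ) :
    |(|a| ^ γ - |b| ^ γ)| ≤ |a - b| ^ γ := by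
  have key : ∀ a b : ℝ, |a| ^ γ - |b| ^ γ ≤ |a - b| ^ γ := fun a b => by
    have h1 : |a| ^ γ ≤ (|a - b| + |b|) ^ γ := by
      gcongr
      simpa using abs_add_le (a - b) b
    linarith [rpow_add_le_add_rpow (abs_nonneg (a - b)) (abs_nonneg b) hγ hγ1]
  rw [abs_le]
  exact ⟨by linarith [abs_sub_comm a b ▸ key b a], key a b⟩

lemma abs_abs_rpow_sub_le_of_one_lt {γ : ℝ} (hγ : 1 < γ) (a b : ℝ) :
    |(|a| ^ γ - |b| ^ γ)| ≤
      γ * 2 ^ (γ - 1) * (|a - b| ^ γ + |a - b| * |b| ^ (γ - 1)) := by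
  have hg : 0 ≤ γ - 1 := by linarith
  have hm : ∀ m : ℝ, 0 ≤ m → m ≤ |a - b| + |b| → γ * m ^ (γ - 1) * |a - b| ≤
      γ * 2 ^ (γ - 1) * (|a - b| ^ γ + |a - b| * |b| ^ (γ - 1)) := fun m hm0 hm => by
    have h1 : m ^ (γ - 1) ≤ 2 ^ (γ - 1) * (|a - b| ^ (γ - 1) + |b| ^ (γ - 1)) :=
      (rpow_le_rpow hm0 hm hg).trans
        (add_rpow_le_two_rpow_mul (abs_nonneg _) (abs_nonneg _) hg)
    have h2 : |a - b| ^ γ = |a - b| ^ (γ - 1) * |a - b| := by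
      rw [← rpow_add_one' (abs_nonneg _) (by linarith), sub_add_cancel]
    calc γ * m ^ (γ - 1) * |a - b|
        ≤ γ * (2 ^ (γ - 1) * (|a - b| ^ (γ - 1) + |b| ^ (γ - 1))) * |a - b| := by gcongr
      _ = _ := by rw [h2]; ring
  have ha : |a| ≤ |a - b| + |b| := by simpa using abs_add_le (a - b) b
  have hab := abs_abs_sub_abs_le_abs_sub a b
  rcases le_total |b| |a| with h | h
  · rw [abs_of_nonneg (sub_nonneg.2 (rpow_le_rpow (abs_nonneg _) h (by linarith)))]
    refine (rpow_sub_rpow_le_mul hγ.le (abs_nonneg _) h).trans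
      (le_trans ?_ (hm |a| (abs_nonneg _) ha))
    gcongr
    exact (le_abs_self _).trans hab
  · rw [abs_sub_comm,
      abs_of_nonneg (sub_nonneg.2 (rpow_le_rpow (abs_nonneg _) h (by linarith)))]
    refine (rpow_sub_rpow_le_mul hγ.le (abs_nonneg _) h).trans
      (le_trans ?_ (hm |b| (abs_nonneg _) (by linarith [abs_nonneg (a - b)])))
    gcongr
    rw [abs_sub_comm] at hab
    exact (le_abs_self _).trans hab

/-- The order of magnitude `1 + |t| ^ (γ - 1)` of the increments of `|·| ^ γ` near `t`, the second
term being present only if `1 < γ`. -/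
noncomputable def incrementScale (γ t : ℝ) : ℝ := 1 + if 1 < γ then |t| ^ (γ - 1) else 0

lemma one_le_incrementScale (γ t : ℝ) : 1 ≤ incrementScale γ t := by
  unfold incrementScale
  split_ifs <;> simp [rpow_nonneg]

lemma abs_rpow_le_one_add_sq_pow {p : ℝ} {n : ℕ} (hp : 0 ≤ p) (hpn : p ≤ n) (u : ℝ) :
    |u| ^ p ≤ (1 + u ^ 2) ^ n := by
  have h1 : (1 : ℝ) ≤ 1 + u ^ 2 := by nlinarith [sq_nonneg u]
  have h2 : |u| ≤ 1 + u ^ 2 := by nlinarith [sq_abs u, sq_nonneg (|u| - 1), abs_nonneg u]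
  calc |u| ^ p ≤ (1 + u ^ 2) ^ p := by gcongr
    _ ≤ (1 + u ^ 2) ^ (n : ℝ) := rpow_le_rpow_of_exponent_le h1 hpn
    _ = _ := rpow_natCast _ _

lemma exists_rpow_le_mul_exp {p : ℝ} (hp : 0 ≤ p) :
    ∃ C : ℝ, 0 < C ∧ ∀ x : ℝ, |x| ^ p ≤ C * rexp |x| := by
  obtain ⟨n, hn⟩ := exists_nat_ge p
  refine ⟨n.factorial * rexp 1, by positivity, fun x => ?_⟩
  have h1 : |x| ^ p ≤ (1 + |x|) ^ n := by
    calc |x| ^ p ≤ (1 + |x|) ^ p := by gcongr; linarith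
      _ ≤ (1 + |x|) ^ (n : ℝ) :=
        rpow_le_rpow_of_exponent_le (by linarith [abs_nonneg x]) hn
      _ = _ := rpow_natCast _ _
  have h2 := Real.pow_div_factorial_le_exp (1 + |x|) (by positivity) n
  rw [div_le_iff₀ (by positivity), Real.exp_add] at h2
  linarith

lemma exists_abs_rpow_increment_le {γ : ℝ} (hγ : 0 < γ) {n : ℕ} (hn : γ ≤ n) :
    ∃ C : ℝ, 0 < C ∧ ∀ t u x : ℝ, |(|t + x - u| ^ γ - |t - u| ^ γ)| ≤
      C * incrementScale γ t * (1 + u ^ 2) ^ n * rexp |x| := by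
  obtain ⟨D, hD, hDx⟩ := exists_rpow_le_mul_exp hγ.le
  have hw : ∀ u : ℝ, (1 : ℝ) ≤ (1 + u ^ 2) ^ n := fun u =>
    one_le_pow₀ (by nlinarith [sq_nonneg u])
  rcases le_or_gt γ 1 with h | h
  · refine ⟨D, hD, fun t u x => ?_⟩
    have := abs_abs_rpow_sub_le_of_le_one hγ.le h (t + x - u) (t - u)
    rw [show t + x - u - (t - u) = x by ring] at this
    rw [incrementScale, if_neg h.not_gt, add_zero, mul_one]
    calc _ ≤ D * 1 * rexp |x| := by linarith [hDx x]
      _ ≤ _ := by gcongr; exact hw u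
  · refine ⟨γ * 2 ^ (γ - 1) * (D + 2 ^ (γ - 1)), by positivity, fun t u x => ?_⟩
    have hb := abs_abs_rpow_sub_le_of_one_lt h (t + x - u) (t - u)
    rw [show t + x - u - (t - u) = x by ring] at hb
    have hs := one_le_incrementScale γ t
    have hg : 0 ≤ γ - 1 := by linarith
    have h1 : |t - u| ^ (γ - 1) ≤ 2 ^ (γ - 1) * (incrementScale γ t * (1 + u ^ 2) ^ n) := by
      have ha : |t - u| ^ (γ - 1) ≤ (|t| + |u|) ^ (γ - 1) := by
        gcongr
        exact abs_sub _ _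
      refine ha.trans ((add_rpow_le_two_rpow_mul (abs_nonneg _) (abs_nonneg _) hg).trans ?_)
      gcongr
      rw [incrementScale, if_pos h]
      have hu := abs_rpow_le_one_add_sq_pow hg (by linarith : γ - 1 ≤ n) u
      have ht := rpow_nonneg (abs_nonneg t) (γ - 1)
      nlinarith [hw u]
    have h2 : |x| ≤ rexp |x| := by linarith [add_one_le_exp |x|]
    have h3 : (1 : ℝ) ≤ incrementScale γ t * (1 + u ^ 2) ^ n :=
      one_le_mul_of_one_le_of_one_le hs (hw u)
    calc _ ≤ _ := hb
      _ ≤ γ * 2 ^ (γ - 1) * (D * rexp |x| * (incrementScale γ t * (1 + u ^ 2) ^ n) +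
          rexp |x| * (2 ^ (γ - 1) * (incrementScale γ t * (1 + u ^ 2) ^ n))) := by
        gcongr
        exact (hDx x).trans (le_mul_of_one_le_right (by positivity) h3)
      _ = _ := by ring

lemma exists_abs_rpow_sub_le {γ : ℝ} (hγ : 0 < γ) {n : ℕ} (hn : γ ≤ n) :
    ∃ C : ℝ, 0 < C ∧ ∀ t u : ℝ, |(|t - u| ^ γ - |t| ^ γ)| ≤
      C * incrementScale γ t * (1 + u ^ 2) ^ n := by
  have hwu := abs_rpow_le_one_add_sq_pow hγ.le hn
  rcases le_or_gt γ 1 with h | h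
  · refine ⟨1, one_pos, fun t u => ?_⟩
    have := abs_abs_rpow_sub_le_of_le_one hγ.le h (t - u) t
    rw [sub_sub_cancel_left, abs_neg] at this
    rw [incrementScale, if_neg h.not_gt, add_zero, mul_one, one_mul]
    exact this.trans (hwu u)
  · refine ⟨γ * 2 ^ (γ - 1), by positivity, fun t u => ?_⟩
    have hb := abs_abs_rpow_sub_le_of_one_lt h (t - u) t
    rw [sub_sub_cancel_left, abs_neg] at hb
    refine hb.trans ?_
    rw [incrementScale, if_pos h, mul_assoc _ (1 + _), add_mul, one_mul, mul_comm |u|]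
    gcongr
    · exact hwu u
    · simpa using abs_rpow_le_one_add_sq_pow zero_le_one (by linarith : (1 : ℝ) ≤ n) u

lemma integrable_exp_mul_abs_gaussianReal (c : ℝ) (v : NNReal) :
    Integrable (fun z => rexp (c * |z|)) (gaussianReal 0 v) :=
  integrable_exp_mul_abs (integrable_exp_mul_gaussianReal c) (integrable_exp_mul_gaussianReal (-c))

lemma integral_exp_mul_abs_gaussianReal_le (c : ℝ) (v : NNReal) :
    ∫ z, rexp (c * |z|) ∂gaussianReal 0 v ≤ 2 * rexp (v * c ^ 2 / 2) := by
  have hm : ∀ t : ℝ, ∫ z, rexp (t * z) ∂gaussianReal 0 v = rexp (v * t ^ 2 / 2) := fun t => by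
    have := mgf_gaussianReal (p := gaussianReal 0 v) (X := id) (μ := 0) (v := v)
      Measure.map_id t
    simpa [mgf] using this
  calc ∫ z, rexp (c * |z|) ∂gaussianReal 0 v
      ≤ ∫ z, (rexp (c * z) + rexp (-c * z)) ∂gaussianReal 0 v := by
        refine integral_mono (integrable_exp_mul_abs_gaussianReal c v)
          ((integrable_exp_mul_gaussianReal c).add (integrable_exp_mul_gaussianReal (-c)))
          fun z => ?_
        rcases abs_cases z with ⟨h, -⟩ | ⟨h, -⟩
        · simp only [h]
          linarith [exp_pos (-c * z)]
        · simp only [h, mul_neg, ← neg_mul]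
          linarith [exp_pos (c * z)]
    _ = _ := by
        rw [integral_add (integrable_exp_mul_gaussianReal c) (integrable_exp_mul_gaussianReal (-c)),
          hm, hm, neg_sq, two_mul]

/-- The average of `Re K` over Gaussian imaginary shifts. Convolving it with `N(0, v)` gives back
`Re K` on the real line when `K` is entire of exponential type. -/
noncomputable def gaussianDeconv (K : ℂ → ℂ) (v : NNReal) (u : ℝ) : ℝ :=
  ∫ z, (K (u + z * Complex.I)).re ∂gaussianReal 0 v

section deconv

variable {K : ℂ → ℂ} {A c : ℝ} {n : ℕ} {v : NNReal}

lemma measurable_gaussianDeconv (hK : Continuous K) : Measurable (gaussianDeconv K v) := by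
  have : StronglyMeasurable fun p : ℝ × ℝ => (K (p.1 + p.2 * Complex.I)).re :=
    Continuous.stronglyMeasurable (by fun_prop)
  exact this.integral_prod_right.measurable

lemma abs_gaussianDeconv_le (hA : 0 < A) (hb : ∀ x y : ℝ, ‖K (x + y * Complex.I)‖ ≤
    A * rexp (c * |y|) * ((1 + x ^ 2) ^ (n + 1))⁻¹) (u : ℝ) :
    |gaussianDeconv K v u| ≤ A * (2 * rexp (v * c ^ 2 / 2)) * ((1 + u ^ 2) ^ (n + 1))⁻¹ := by
  have hi := ((integrable_exp_mul_abs_gaussianReal c v).const_mul A).mul_const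
    ((1 + u ^ 2) ^ (n + 1))⁻¹
  refine (norm_integral_le_of_norm_le hi (ae_of_all _ fun z =>
    (norm_eq_abs _).trans_le ((Complex.abs_re_le_norm _).trans (hb u z)))).trans ?_
  rw [integral_mul_const, integral_const_mul]
  gcongr
  exact integral_exp_mul_abs_gaussianReal_le c v

lemma integral_gaussianDeconv_add (hK : Differentiable ℂ K) (hv : v ≠ 0) (hA : 0 < A)
    (hb : ∀ x y : ℝ, ‖K (x + y * Complex.I)‖ ≤
      A * rexp (c * |y|) * ((1 + x ^ 2) ^ (n + 1))⁻¹) (w : ℝ) :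
    ∫ x, gaussianDeconv K v (x + w) ∂gaussianReal 0 v = (K w).re := by
  have hd : Differentiable ℂ fun z => K (z + w) := hK.comp (differentiable_id.add_const _)
  have hi : Integrable (fun p : ℝ × ℝ => K ((p.1 + p.2 * Complex.I) + w))
      ((gaussianReal 0 v).prod (gaussianReal 0 v)) := by
    refine Integrable.mono' (((integrable_exp_mul_abs_gaussianReal c v).const_mul A).comp_snd
      (gaussianReal 0 v)) (Continuous.aestronglyMeasurable
        (by have := hK.continuous; fun_prop)) (ae_of_all _ fun p => ?_)
    have h := hb (p.1 + w) p.2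
    rw [show ((p.1 + w : ℝ) : ℂ) + p.2 * Complex.I = (p.1 + p.2 * Complex.I) + w by
      push_cast; ring] at h
    refine h.trans (mul_le_of_le_one_right (by positivity) (inv_le_one_of_one_le₀ ?_))
    exact one_le_pow₀ (by nlinarith [sq_nonneg (p.1 + w)])
  have h := congrArg Complex.re (integral_gaussian_prod_entire hd hv hi)
  rw [zero_add] at h
  rw [← h, ← RCLike.re_eq_complex_re, ← integral_re hi, integral_prod _ hi.re]
  refine integral_congr_ae (ae_of_all _ fun x => ?_)
  simp only [gaussianDeconv]
  refine integral_congr_ae (ae_of_all _ fun z => ?_)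
  simp only [Complex.ofReal_add]
  congr 2
  ring

end deconv

lemma integrable_mul_of_abs_le {F h : ℝ → ℝ} (hF : Measurable F) (hh : Measurable h) {M P : ℝ}
    {n : ℕ} (hM : ∀ u, |F u| ≤ M * (1 + u ^ 2) ^ n)
    (hP : ∀ u, |h u| ≤ P * ((1 + u ^ 2) ^ (n + 1))⁻¹) :
    Integrable (fun u => F u * h u) ∧ |∫ u, F u * h u| ≤ M * P * π := by
  have hle : ∀ u, ‖F u * h u‖ ≤ M * P * (1 + u ^ 2)⁻¹ := fun u => by
    rw [norm_mul, norm_eq_abs, norm_eq_abs]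
    have h1 : 0 ≤ M * (1 + u ^ 2) ^ n := (abs_nonneg _).trans (hM u)
    calc _ ≤ (M * (1 + u ^ 2) ^ n) * (P * ((1 + u ^ 2) ^ (n + 1))⁻¹) :=
          mul_le_mul (hM u) (hP u) (abs_nonneg _) h1
      _ = _ := by
          rw [pow_succ]
          field_simp
          ring
  have hi := integrable_inv_one_add_sq.const_mul (M * P)
  refine ⟨hi.mono' (hF.mul hh).aestronglyMeasurable (ae_of_all _ hle), ?_⟩
  have := norm_integral_le_of_norm_le hi (ae_of_all _ hle)
  rwa [integral_const_mul, integral_univ_inv_one_add_sq] at this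

lemma integral_gaussianReal_eq_add (f : ℝ → ℝ) (t : ℝ) (v : NNReal) :
    ∫ y, f y ∂gaussianReal t v = ∫ x, f (t + x) ∂gaussianReal 0 v := by
  have h := gaussianReal_map_const_add (μ := 0) (v := v) t
  rw [zero_add] at h
  rw [← h]
  exact integral_map_equiv (MeasurableEquiv.addLeft t) f

lemma integrable_gaussianReal_iff_add {f : ℝ → ℝ} (t : ℝ) (v : NNReal) :
    Integrable f (gaussianReal t v) ↔ Integrable (fun x => f (t + x)) (gaussianReal 0 v) := by
  have h := gaussianReal_map_const_add (μ := 0) (v := v) t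
  rw [zero_add] at h
  rw [← h]
  exact integrable_map_equiv (MeasurableEquiv.addLeft t) f

lemma integral_gaussianDeconv_estimator {K : ℂ → ℂ} (hK : Differentiable ℂ K) {A c γ : ℝ} {n : ℕ}
    {v : NNReal} (hv : v ≠ 0) (hA : 0 < A) (hγ : 0 < γ) (hn : γ ≤ n)
    (hb : ∀ x y : ℝ, ‖K (x + y * Complex.I)‖ ≤
      A * rexp (c * |y|) * ((1 + x ^ 2) ^ (n + 1))⁻¹) (t : ℝ) :
    ∫ y, (∫ u, |y - u| ^ γ * gaussianDeconv K v u) ∂gaussianReal t v =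
      ∫ w : ℝ, |t - w| ^ γ * (K w).re := by
  obtain ⟨C₁, hC₁, h₁⟩ := exists_abs_rpow_increment_le hγ hn
  obtain ⟨C₂, hC₂, h₂⟩ := exists_abs_rpow_sub_le hγ hn
  have hH := measurable_gaussianDeconv (v := v) hK.continuous
  have hHb := abs_gaussianDeconv_le (v := v) hA hb
  set P := A * (2 * rexp (v * c ^ 2 / 2))
  set S := incrementScale γ t
  have hS : 1 ≤ S := one_le_incrementScale γ t
  set M := |t| ^ γ + C₂ * S + C₁ * S
  have hF : Measurable fun p : ℝ × ℝ => |t + p.1 - p.2| ^ γ * gaussianDeconv K v p.2 := by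
    fun_prop
  have hFi : Integrable (fun p : ℝ × ℝ => |t + p.1 - p.2| ^ γ * gaussianDeconv K v p.2)
      ((gaussianReal 0 v).prod volume) := by
    have hd := ((integrable_exp_mul_abs_gaussianReal 1 v).const_mul M).mul_prod
      (integrable_inv_one_add_sq.const_mul P)
    refine hd.mono' hF.aestronglyMeasurable (ae_of_all _ fun ⟨x, u⟩ => ?_)
    have hw : (1 : ℝ) ≤ (1 + u ^ 2) ^ n := one_le_pow₀ (by nlinarith [sq_nonneg u])
    have he : 1 ≤ rexp |x| := one_le_exp (abs_nonneg x)
    have hwe := one_le_mul_of_one_le_of_one_le hw he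
    have hle : |t + x - u| ^ γ ≤ M * (1 + u ^ 2) ^ n * rexp |x| := by
      have e₁ := (abs_le.1 (h₁ t u x)).2
      have e₂ := (abs_le.1 (h₂ t u)).2
      have e₃ : |t| ^ γ ≤ |t| ^ γ * ((1 + u ^ 2) ^ n * rexp |x|) :=
        le_mul_of_one_le_right (by positivity) hwe
      have e₄ : C₂ * S * (1 + u ^ 2) ^ n ≤ C₂ * S * (1 + u ^ 2) ^ n * rexp |x| :=
        le_mul_of_one_le_right (by positivity) he
      calc _ ≤ |t| ^ γ * ((1 + u ^ 2) ^ n * rexp |x|) + C₂ * S * (1 + u ^ 2) ^ n * rexp |x| +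
            C₁ * S * (1 + u ^ 2) ^ n * rexp |x| := by linarith
        _ = _ := by ring
    simp only [norm_mul, norm_eq_abs, one_mul]
    rw [abs_of_nonneg (rpow_nonneg (abs_nonneg _) _)]
    calc _ ≤ (M * (1 + u ^ 2) ^ n * rexp |x|) * (P * ((1 + u ^ 2) ^ (n + 1))⁻¹) := by
          gcongr
          exact hHb u
      _ = _ := by
          rw [pow_succ]
          field_simp
          ring
  have hsh := measurePreserving_prod_add (gaussianReal 0 v) (volume : Measure ℝ)
  rw [integral_gaussianReal_eq_add]
  rw [← integral_prod (fun p : ℝ × ℝ => |t + p.1 - p.2| ^ γ * gaussianDeconv K v p.2) hFi]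
  have hcomp := hsh.integral_comp (MeasurableEquiv.shearAddRight ℝ).measurableEmbedding
    (fun p : ℝ × ℝ => |t + p.1 - p.2| ^ γ * gaussianDeconv K v p.2)
  rw [← hcomp, integral_prod_symm]
  · refine integral_congr_ae (ae_of_all _ fun w => ?_)
    simp only [show ∀ x : ℝ, t + x - (x + w) = t - w from fun x => by ring]
    rw [integral_const_mul, integral_gaussianDeconv_add hK hv hA hb]
  · exact hsh.integrable_comp_of_integrable hFi

/-- In one dimension, `|t| ^ γ` can be estimated from `N(t, v)` with bias at most of order
`1 + |t| ^ (γ - 1)`, no bias at `t = 0`, and a variance exponential in `v`. -/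
lemma exists_one_dim_estimator {γ : ℝ} (hγ : 0 < γ) : ∃ C : ℝ, 0 < C ∧ ∀ v : NNReal, v ≠ 0 →
    ∃ g : ℝ → ℝ, Measurable g ∧ ∀ t : ℝ, MemLp g 2 (gaussianReal t v) ∧
      |∫ y, g y ∂gaussianReal t v - |t| ^ γ| ≤ (if t = 0 then 0 else C * incrementScale γ t) ∧
      Var[g; gaussianReal t v] ≤ C * rexp (C * v) * incrementScale γ t ^ 2 := by
  obtain ⟨n, hn⟩ := exists_nat_ge γ
  obtain ⟨C₁, hC₁, h₁⟩ := exists_abs_rpow_increment_le hγ hn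
  obtain ⟨C₂, hC₂, h₂⟩ := exists_abs_rpow_sub_le hγ hn
  obtain ⟨K, hK, hK0, hKnn, A, c, hA, hc, hb⟩ := exists_entire_kernel n
  have hkm : Measurable fun u : ℝ => (K u).re :=
    (Complex.continuous_re.comp (hK.continuous.comp Complex.continuous_ofReal)).measurable
  have hkb : ∀ u : ℝ, |(K u).re| ≤ A * ((1 + u ^ 2) ^ (n + 1))⁻¹ := fun u =>
    (Complex.abs_re_le_norm _).trans (by simpa using hb u 0)
  have hki : Integrable fun u : ℝ => (K u).re := by
    have := (integrable_mul_of_abs_le (F := fun _ => 1) (M := 1) measurable_const hkm (fun u => by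
      simpa using one_le_pow₀ (by nlinarith [sq_nonneg u] : (1 : ℝ) ≤ 1 + u ^ 2)) hkb).1
    simpa using this
  have hκ : 0 < ∫ u : ℝ, (K u).re := by
    have hcont : Continuous fun u : ℝ => (K u).re :=
      Complex.continuous_re.comp (hK.continuous.comp Complex.continuous_ofReal)
    rw [integral_pos_iff_support_of_nonneg hKnn hki]
    exact hcont.isOpen_support.measure_pos _ ⟨0, by simp [hK0]⟩
  set κ := ∫ u : ℝ, (K u).re
  have hwt : ∀ u : ℝ, (1 : ℝ) ≤ (1 + u ^ 2) ^ n := fun u =>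
    one_le_pow₀ (by nlinarith [sq_nonneg u])
  have hpm : ∀ y : ℝ, Measurable fun u : ℝ => |y - u| ^ γ := fun y => by fun_prop
  have hpb : ∀ y u : ℝ, |(|y - u| ^ γ)| ≤
      (|y| ^ γ + C₂ * incrementScale γ y) * (1 + u ^ 2) ^ n := fun y u => by
    rw [abs_of_nonneg (rpow_nonneg (abs_nonneg _) _), add_mul]
    linarith [(abs_le.1 (h₂ y u)).2,
      le_mul_of_one_le_right (rpow_nonneg (abs_nonneg y) γ) (hwt u)]
  set B := κ⁻¹ * ((C₂ + 1) * A * π)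
  set D := κ⁻¹ * (C₁ * (A * 2) * π)
  have hB : 0 < B := by positivity
  have hD : 0 < D := by positivity
  refine ⟨B + 2 * D ^ 2 + (c ^ 2 + 2), by positivity, fun v hv => ?_⟩
  have hH := measurable_gaussianDeconv (v := v) hK.continuous
  have hHb := abs_gaussianDeconv_le (v := v) hA hb
  set H := gaussianDeconv K v
  set g : ℝ → ℝ := fun y => κ⁻¹ * ((∫ u, |y - u| ^ γ * H u) - ∫ u : ℝ, |(0 : ℝ) - u| ^ γ * (K u).re)
  have hg : Measurable g := by
    have : StronglyMeasurable fun p : ℝ × ℝ => |p.1 - p.2| ^ γ * H p.2 :=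
      Measurable.stronglyMeasurable (by fun_prop)
    exact (this.integral_prod_right.measurable.sub_const _).const_mul _
  have hHi : ∀ y, Integrable fun u => |y - u| ^ γ * H u := fun y =>
    (integrable_mul_of_abs_le (hpm y) hH (hpb y) hHb).1
  have hinc : ∀ t x, |g (t + x) - g t| ≤
      D * incrementScale γ t * rexp (v * c ^ 2 / 2) * rexp |x| := fun t x => by
    have heq : g (t + x) - g t = κ⁻¹ * ∫ u, (|t + x - u| ^ γ - |t - u| ^ γ) * H u := by
      simp only [g, sub_mul]
      rw [integral_sub (hHi _) (hHi _)]
      ring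
    rw [heq, abs_mul, abs_of_pos (inv_pos.2 hκ)]
    have := (integrable_mul_of_abs_le ((hpm (t + x)).sub (hpm t)) hH
      (M := C₁ * incrementScale γ t * rexp |x|)
      (fun u => (h₁ t u x).trans_eq (by ring)) hHb).2
    calc _ ≤ κ⁻¹ * _ := mul_le_mul_of_nonneg_left this (by positivity)
      _ = _ := by simp only [D]; ring
  have hsq : ∀ t x, (g (t + x) - g t) ^ 2 ≤
      D ^ 2 * incrementScale γ t ^ 2 * rexp (c ^ 2 * v) * rexp (2 * |x|) := fun t x => by
    rw [← sq_abs]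
    calc _ ≤ (D * incrementScale γ t * rexp (v * c ^ 2 / 2) * rexp |x|) ^ 2 := by
          gcongr
          exact hinc t x
      _ = _ := by
          rw [mul_pow, mul_pow, mul_pow, ← Real.exp_nat_mul, ← Real.exp_nat_mul]
          push_cast
          congr 3
          ring_nf
  have hi2 := integrable_exp_mul_abs_gaussianReal 2 v
  refine ⟨g, hg, fun t => ?_⟩
  have hS := one_le_incrementScale γ t
  have hdi : Integrable (fun x => (g (t + x) - g t) ^ 2) (gaussianReal 0 v) :=
    (hi2.const_mul _).mono'
      (((hg.comp (measurable_const_add t)).sub_const (g t)).pow_const 2).aestronglyMeasurable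
      (ae_of_all _ fun x => by
      rw [norm_of_nonneg (sq_nonneg _)]
      exact hsq t x)
  have hdL : MemLp (fun y => g y - g t) 2 (gaussianReal t v) := by
    rw [memLp_two_iff_integrable_sq (by fun_prop), integrable_gaussianReal_iff_add]
    exact hdi
  have hL : MemLp g 2 (gaussianReal t v) := by
    have h := hdL.add (memLp_const (g t))
    rwa [show ((fun y => g y - g t) + fun _ => g t) = g from funext fun y => by simp] at h
  refine ⟨hL, ?_, ?_⟩
  · have hEi : Integrable (fun y => ∫ u, |y - u| ^ γ * H u) (gaussianReal t v) := by
      have h := ((hL.integrable one_le_two).const_mul κ).add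
        (integrable_const (∫ u : ℝ, |(0 : ℝ) - u| ^ γ * (K u).re))
      refine h.congr (ae_of_all _ fun y => ?_)
      simp only [Pi.add_apply, g]
      field_simp
      ring
    have hE : ∫ y, g y ∂gaussianReal t v =
        κ⁻¹ * ((∫ u : ℝ, |t - u| ^ γ * (K u).re) - ∫ u : ℝ, |(0 : ℝ) - u| ^ γ * (K u).re) := by
      simp only [g]
      rw [integral_const_mul, integral_sub hEi (integrable_const _),
        integral_gaussianDeconv_estimator hK hv hA hγ hn hb]
      simp
    rw [hE]
    split_ifs with ht
    · simp [ht, zero_rpow hγ.ne']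
    · have hki' : ∀ y, Integrable fun u : ℝ => |y - u| ^ γ * (K u).re := fun y =>
        (integrable_mul_of_abs_le (hpm y) hkm (hpb y) hkb).1
      have heq : κ⁻¹ * ((∫ u : ℝ, |t - u| ^ γ * (K u).re) - ∫ u : ℝ, |(0 : ℝ) - u| ^ γ * (K u).re) -
          |t| ^ γ = κ⁻¹ * ∫ u : ℝ, (|t - u| ^ γ - |(0 : ℝ) - u| ^ γ - |t| ^ γ) * (K u).re := by
        simp only [sub_mul]
        have h : Integrable fun u : ℝ => |t - u| ^ γ * (K u).re - |(0 : ℝ) - u| ^ γ * (K u).re :=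
          (hki' t).sub (hki' 0)
        rw [integral_sub h (hki.const_mul (|t| ^ γ)), integral_sub (hki' t) (hki' 0),
          integral_const_mul]
        field_simp
        exact congrArg _ (mul_comm _ _)
      rw [heq, abs_mul, abs_of_pos (inv_pos.2 hκ)]
      have := (integrable_mul_of_abs_le (F := fun u => |t - u| ^ γ - |(0 : ℝ) - u| ^ γ - |t| ^ γ)
        (by fun_prop) hkm
        (M := (C₂ + 1) * incrementScale γ t) (fun u => by
          have e₁ := h₂ t u
          have e₂ := abs_rpow_le_one_add_sq_pow hγ.le hn u
          have e₃ : (1 + u ^ 2) ^ n ≤ incrementScale γ t * (1 + u ^ 2) ^ n :=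
            le_mul_of_one_le_left (by positivity) hS
          have e₄ := rpow_nonneg (abs_nonneg u) γ
          rw [abs_le] at e₁ ⊢
          rw [zero_sub, abs_neg]
          constructor <;> linarith) hkb).2
      calc _ ≤ κ⁻¹ * _ := mul_le_mul_of_nonneg_left this (by positivity)
        _ = B * incrementScale γ t := by simp only [B]; ring
        _ ≤ _ := by
          gcongr
          nlinarith [sq_nonneg D, sq_nonneg c]
  · rw [← variance_sub_const hg.aestronglyMeasurable (g t)]
    refine (variance_le_expectation_sq (by fun_prop)).trans ?_
    simp only [Pi.pow_apply]
    rw [integral_gaussianReal_eq_add]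
    have h2 := integral_exp_mul_abs_gaussianReal_le 2 v
    rw [show (v : ℝ) * 2 ^ 2 / 2 = 2 * v by ring] at h2
    calc _ ≤ ∫ x, D ^ 2 * incrementScale γ t ^ 2 * rexp (c ^ 2 * v) * rexp (2 * |x|)
          ∂gaussianReal 0 v := integral_mono hdi (hi2.const_mul _) (hsq t)
      _ ≤ D ^ 2 * incrementScale γ t ^ 2 * rexp (c ^ 2 * v) * (2 * rexp (2 * v)) := by
        rw [integral_const_mul]
        gcongr
      _ = (2 * D ^ 2) * rexp ((c ^ 2 + 2) * v) * incrementScale γ t ^ 2 := by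
        rw [add_mul, Real.exp_add]
        ring
      _ ≤ _ := by
        have e₁ : 2 * D ^ 2 ≤ B + 2 * D ^ 2 + (c ^ 2 + 2) := by nlinarith [sq_nonneg c]
        have e₂ : c ^ 2 + 2 ≤ B + 2 * D ^ 2 + (c ^ 2 + 2) := by nlinarith [sq_nonneg D]
        gcongr

lemma exists_one_dim_estimator_scaled {γ : ℝ} (hγ : 0 < γ) : ∃ C : ℝ, 0 < C ∧
    ∀ (v : NNReal) (δ : ℝ), v ≠ 0 → 0 < δ → ∃ g : ℝ → ℝ, Measurable g ∧
      ∀ t : ℝ, MemLp g 2 (gaussianReal t (δ ^ 2 * v).toNNReal) ∧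
        |∫ y, g y ∂gaussianReal t (δ ^ 2 * v).toNNReal - |t| ^ γ| ≤
          (if t = 0 then 0 else C * (δ ^ γ * incrementScale γ (t / δ))) ∧
        Var[g; gaussianReal t (δ ^ 2 * v).toNNReal] ≤
          C * rexp (C * v) * (δ ^ γ * incrementScale γ (t / δ)) ^ 2 := by
  obtain ⟨C, hC, h⟩ := exists_one_dim_estimator hγ
  refine ⟨C, hC, fun v δ hv hδ => ?_⟩
  obtain ⟨g, hg, H⟩ := h v hv
  have hm : Measurable fun y => δ ^ γ * g (y / δ) := by fun_prop
  refine ⟨fun y => δ ^ γ * g (y / δ), hm, fun t => ?_⟩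
  have hmap : gaussianReal t (δ ^ 2 * v).toNNReal =
      (gaussianReal (t / δ) v).map fun x => δ * x := by
    rw [gaussianReal_map_const_mul, mul_div_cancel₀ _ hδ.ne']
    congr 1
    ext
    rw [Real.coe_toNNReal _ (by positivity)]
    rfl
  have hcomp : ∀ x, δ ^ γ * g (δ * x / δ) = δ ^ γ * g x := fun x => by
    rw [mul_div_cancel_left₀ _ hδ.ne']
  obtain ⟨hL, hbias, hvar⟩ := H (t / δ)
  have hδγ : 0 < δ ^ γ := rpow_pos_of_pos hδ γ
  rw [hmap]
  refine ⟨?_, ?_, ?_⟩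
  · rw [memLp_map_measure_iff hm.aestronglyMeasurable (by fun_prop)]
    exact (hL.const_mul (δ ^ γ)).congr_norm
      (hm.comp (measurable_const_mul δ)).aestronglyMeasurable (ae_of_all _ fun x => by
      simp only [Function.comp_apply, hcomp])
  · rw [integral_map (by fun_prop) hm.aestronglyMeasurable]
    simp only [hcomp]
    rw [integral_const_mul]
    have ht : |t| ^ γ = δ ^ γ * |t / δ| ^ γ := by
      rw [← mul_rpow hδ.le (abs_nonneg _), abs_div, abs_of_pos hδ, mul_div_cancel₀ _ hδ.ne']
    rw [ht, ← mul_sub, abs_mul, abs_of_pos hδγ]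
    calc _ ≤ δ ^ γ * _ := mul_le_mul_of_nonneg_left hbias hδγ.le
      _ = _ := by
        simp only [div_eq_zero_iff, hδ.ne', or_false]
        split_ifs
        · simp
        · ring
  · rw [variance_map (by fun_prop) (by fun_prop)]
    simp only [Function.comp_def, hcomp]
    rw [variance_const_mul]
    calc _ ≤ (δ ^ γ) ^ 2 * _ := mul_le_mul_of_nonneg_left hvar (sq_nonneg _)
      _ = _ := by ring

lemma integral_sq_sub_eq_variance_add {Ω : Type*} [MeasurableSpace Ω] {μ : Measure Ω}
    [IsProbabilityMeasure μ] {X : Ω → ℝ} (hX : MemLp X 2 μ) (a : ℝ) :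
    ∫ ω, (X ω - a) ^ 2 ∂μ = Var[X; μ] + (∫ ω, X ω ∂μ - a) ^ 2 := by
  have h := variance_eq_sub (hX.sub (memLp_const a))
  have e : ∫ ω, (X - fun _ => a : Ω → ℝ) ω ∂μ = ∫ ω, X ω ∂μ - a := by
    simp only [Pi.sub_apply]
    rw [integral_sub (hX.integrable one_le_two) (integrable_const a)]
    simp
  have e' : Var[X - fun _ => a; μ] = Var[X; μ] := variance_sub_const hX.1 a
  rw [e, e'] at h
  simp only [Pi.pow_apply, Pi.sub_apply] at h
  linarith

/-- Bias–variance decomposition for an additive estimator under a product measure. -/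
lemma integral_sq_sum_sub_eq {ι : Type*} [Fintype ι] {μ : ι → Measure ℝ}
    [∀ i, IsProbabilityMeasure (μ i)] {g : ℝ → ℝ} (hg : ∀ i, MemLp g 2 (μ i)) (b : ι → ℝ) :
    ∫ x, (∑ i, g (x i) - ∑ i, b i) ^ 2 ∂Measure.pi μ =
      ∑ i, Var[g; μ i] + (∑ i, (∫ y, g y ∂μ i - b i)) ^ 2 := by
  have hi : ∀ i, MemLp (fun x : ι → ℝ => g (x i)) 2 (Measure.pi μ) := fun i =>
    (hg i).comp_measurePreserving (measurePreserving_eval μ i)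
  rw [integral_sq_sub_eq_variance_add (memLp_finsetSum _ fun i _ => hi i)]
  congr 1
  · have := variance_sum_pi (X := fun _ => g) hg
    rw [← this]
    congr 1
    ext x
    simp
  · rw [integral_finsetSum _ fun i _ => (hi i).integrable one_le_two, ← Finset.sum_sub_distrib]
    congr 2
    ext i
    rw [integral_comp_eval (μ := μ) (f := g) (hg i).1]

section powerSums

variable {ι : Type*} [Fintype ι] {γ : ℝ} {x : ι → ℝ} {s : ℕ}

lemma sum_rpow_sub_one_le (hγ : 1 < γ) (hx : ∀ i, 0 ≤ x i)
    (hs : (Finset.univ.filter fun i => x i ≠ 0).card ≤ s) :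
    ∑ i, x i ^ (γ - 1) ≤ (s : ℝ) ^ (1 / γ) * ((∑ i, x i ^ γ) ^ (1 / γ)) ^ (γ - 1) := by
  have hγ0 : 0 < γ := one_pos.trans hγ
  have hpq := HolderConjugate.conjExponent hγ
  have h := inner_le_Lp_mul_Lq_of_nonneg (Finset.univ.filter fun i => x i ≠ 0) hpq
    (f := fun _ => 1) (g := fun i => x i ^ (γ - 1)) (fun _ _ => zero_le_one)
    (fun i _ => rpow_nonneg (hx i) _)
  have hsub : ∀ p : ℝ, p ≠ 0 → ∑ i with x i ≠ 0, x i ^ p = ∑ i, x i ^ p := fun p hp =>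
    Finset.sum_filter_of_ne fun i _ hi h0 => hi (by rw [h0, zero_rpow hp])
  have hpow : ∀ i, (x i ^ (γ - 1)) ^ γ.conjExponent = x i ^ γ := fun i => by
    rw [← rpow_mul (hx i), conjExponent, mul_div_cancel₀ _ (sub_pos.2 hγ).ne']
  simp only [one_mul, one_rpow, hpow, hsub _ hγ0.ne', hsub _ (sub_pos.2 hγ).ne'] at h
  refine h.trans ?_
  rw [← rpow_mul (Finset.sum_nonneg fun i _ => rpow_nonneg (hx i) _),
    show 1 / γ.conjExponent = 1 / γ * (γ - 1) by rw [conjExponent]; field_simp]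
  refine mul_le_mul_of_nonneg_right (rpow_le_rpow (by positivity) ?_ (by positivity))
    (rpow_nonneg (Finset.sum_nonneg fun i _ => rpow_nonneg (hx i) _) _)
  simpa using hs

lemma sum_sq_rpow_sub_one_le (hγ : 1 < γ) (hx : ∀ i, 0 ≤ x i)
    (hs : (Finset.univ.filter fun i => x i ≠ 0).card ≤ s) :
    ∑ i, (x i ^ (γ - 1)) ^ 2 ≤
      (s : ℝ) ^ (1 / γ) * (((∑ i, x i ^ γ) ^ (1 / γ)) ^ (γ - 1)) ^ 2 := by
  have hγ0 : 0 < γ := one_pos.trans hγ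
  have hsum : 0 ≤ ∑ i, x i ^ γ := Finset.sum_nonneg fun i _ => rpow_nonneg (hx i) γ
  set A := ((∑ i, x i ^ γ) ^ (1 / γ)) ^ (γ - 1)
  have hA : 0 ≤ A := rpow_nonneg (rpow_nonneg hsum _) _
  have hle : ∀ i, x i ^ (γ - 1) ≤ A := fun i => by
    refine rpow_le_rpow (hx i) ?_ (sub_pos.2 hγ).le
    rw [one_div, le_rpow_inv_iff_of_pos (hx i) hsum hγ0]
    exact Finset.single_le_sum (f := fun i => x i ^ γ) (fun i _ => rpow_nonneg (hx i) γ)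
      (Finset.mem_univ i)
  calc ∑ i, (x i ^ (γ - 1)) ^ 2 ≤ ∑ i, A * x i ^ (γ - 1) := by
        refine Finset.sum_le_sum fun i _ => ?_
        rw [sq]
        exact mul_le_mul_of_nonneg_right (hle i) (rpow_nonneg (hx i) _)
    _ = A * ∑ i, x i ^ (γ - 1) := (Finset.mul_sum ..).symm
    _ ≤ A * ((s : ℝ) ^ (1 / γ) * A) :=
        mul_le_mul_of_nonneg_left (sum_rpow_sub_one_le hγ hx hs) hA
    _ = _ := by ring

end powerSums

lemma rpow_mul_incrementScale_div {γ δ : ℝ} (hδ : 0 < δ) (t : ℝ) :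
    δ ^ γ * incrementScale γ (t / δ) = δ ^ γ + δ * if 1 < γ then |t| ^ (γ - 1) else 0 := by
  rw [incrementScale, mul_add, mul_one]
  split_ifs
  · rw [abs_div, abs_of_pos hδ, div_rpow (abs_nonneg t) hδ.le, rpow_sub_one hδ.ne']
    field_simp
  · simp

lemma sq_sum_support_le_of_sum_le {ι : Type*} [Fintype ι] {θ a : ι → ℝ} {s : ℕ} {D δ B : ℝ}
    (hD : 0 ≤ D) (hδ : 0 ≤ δ) (ha : ∀ i, 0 ≤ a i)
    (hs : (Finset.univ.filter fun i => θ i ≠ 0).card ≤ s) (hB : ∑ i, a i ≤ B) :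
    (∑ i, if θ i = 0 then 0 else D + δ * a i) ^ 2 ≤
      2 * (D ^ 2 * (s : ℝ) ^ 2 + δ ^ 2 * B ^ 2) := by
  have h0 : 0 ≤ ∑ i, if θ i = 0 then 0 else D + δ * a i := Finset.sum_nonneg fun i _ => by
    have := ha i
    split_ifs <;> positivity
  have hs' : ((Finset.univ.filter fun i => θ i ≠ 0).card : ℝ) ≤ s := by exact_mod_cast hs
  have h : ∑ i, (if θ i = 0 then 0 else D + δ * a i) ≤ D * s + δ * B :=
    calc _ ≤ ∑ i, ((if θ i ≠ 0 then D else 0) + δ * a i) := Finset.sum_le_sum fun i _ => by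
          have := mul_nonneg hδ (ha i)
          by_cases hi : θ i = 0 <;> simp [hi, this]
      _ = D * (Finset.univ.filter fun i => θ i ≠ 0).card + δ * ∑ i, a i := by
          rw [Finset.sum_add_distrib, ← Finset.sum_filter, Finset.sum_const, nsmul_eq_mul,
            mul_comm, Finset.mul_sum]
      _ ≤ _ := by gcongr
  calc _ ≤ (D * s + δ * B) ^ 2 := pow_le_pow_left₀ h0 h 2
    _ ≤ 2 * ((D * s) ^ 2 + (δ * B) ^ 2) := add_sq_le
    _ = _ := by ring

lemma mul_sum_sq_le_of_sum_sq_le {ι : Type*} [Fintype ι] {a : ι → ℝ} {s D δ E p A : ℝ}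
    (hE : 0 ≤ E) (hEp : E ≤ p) (hEs : E * Fintype.card ι ≤ s ^ 2)
    (hA : ∑ i, a i ^ 2 ≤ p * A ^ 2) :
    E * ∑ i, (D + δ * a i) ^ 2 ≤ 2 * (D ^ 2 * s ^ 2 + δ ^ 2 * (p * A) ^ 2) :=
  calc E * ∑ i, (D + δ * a i) ^ 2 ≤ E * ∑ i, (2 * D ^ 2 + 2 * δ ^ 2 * a i ^ 2) := by
        gcongr with i
        exact add_sq_le.trans_eq (by ring)
    _ = 2 * (D ^ 2 * (E * Fintype.card ι) + δ ^ 2 * (E * ∑ i, a i ^ 2)) := by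
        rw [Finset.sum_add_distrib, Finset.sum_const, Finset.card_univ, nsmul_eq_mul,
          ← Finset.mul_sum]
        ring
    _ ≤ 2 * (D ^ 2 * s ^ 2 + δ ^ 2 * (p * (p * A ^ 2))) := by
        have : 0 ≤ ∑ i, a i ^ 2 := Finset.sum_nonneg fun i _ => sq_nonneg _
        gcongr
        exact hE.trans hEp
    _ = _ := by ring

/-- Theorem 1 (dense zone upper bound for estimating `N_γ(θ) = ∑ |θ_i|^γ`).
For every `γ > 0` there is a constant `C > 0` depending only on `γ` such that for all
integers `1 ≤ s ≤ d` with `s² ≥ 4d` and every noise level `ε > 0`, there exists a Borel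
measurable estimator `T : ℝ^d × ℝ^d → ℝ` whose quadratic risk, based on two independent
samples `y_{j,i} ~ N(θ_i, 2ε²)` (all coordinates mutually independent), satisfies the
stated bound for every `s`-sparse `θ`. -/
theorem dense_zone_upper_bound_Ngamma (γ : ℝ) (hγ : 0 < γ) :
    ∃ C : ℝ, 0 < C ∧
      ∀ d s : ℕ, 1 ≤ s → s ≤ d → 4 * d ≤ s ^ 2 →
        ∀ ε : ℝ, 0 < ε →
          ∃ T : (Fin d → ℝ) × (Fin d → ℝ) → ℝ, Measurable T ∧
            ∀ θ : Fin d → ℝ, (Finset.univ.filter fun i => θ i ≠ 0).card ≤ s →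
              ∫ y, (T y - ∑ i, |θ i| ^ γ) ^ 2
                  ∂((Measure.pi fun i : Fin d => gaussianReal (θ i) (2 * ε ^ 2).toNNReal).prod
                    (Measure.pi fun i : Fin d => gaussianReal (θ i) (2 * ε ^ 2).toNNReal))
                ≤ C * (ε ^ (2 * γ) * (s : ℝ) ^ 2 / Real.log ((s : ℝ) ^ 2 / d) ^ γ
                    + ε ^ 2 * (s : ℝ) ^ (2 / γ) / Real.log ((s : ℝ) ^ 2 / d)
                      * ((∑ i, |θ i| ^ γ) ^ (1 / γ)) ^ (2 * γ - 2)
                      * (if 1 < γ then (1 : ℝ) else 0)) := by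
  obtain ⟨C, hC, hest⟩ := exists_one_dim_estimator_scaled hγ
  set η := 1 / (1 + γ)
  have hη : 0 < η := by positivity
  have hη1 : η ≤ 1 := div_le_one_of_le₀ (by linarith) (by positivity)
  have hηγ : η ≤ 1 / γ := one_div_le_one_div_of_le hγ (by linarith)
  set k := 2 * C / η
  have hk : 0 < k := by positivity
  refine ⟨2 * (C ^ 2 + C) * (k ^ γ + k), by positivity, fun d s hs hsd hds ε hε => ?_⟩
  have hs1 : (1 : ℝ) ≤ s := by exact_mod_cast hs
  have hsd' : (s : ℝ) ≤ d := by exact_mod_cast hsd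
  have hds' : 4 * (d : ℝ) ≤ (s : ℝ) ^ 2 := by exact_mod_cast hds
  have hd0 : (0 : ℝ) < d := by linarith
  set q := (s : ℝ) ^ 2 / d
  have hq1 : 1 < q := by
    rw [one_lt_div hd0]
    linarith
  have hqs : q ≤ s := by
    rw [div_le_iff₀ hd0]
    nlinarith
  set ℓ := Real.log q
  have hℓ : 0 < ℓ := Real.log_pos hq1
  set v : NNReal := (η * ℓ / C).toNNReal
  have hv : (v : ℝ) = η * ℓ / C := Real.coe_toNNReal _ (by positivity)
  have hv0 : v ≠ 0 := by
    rw [← NNReal.coe_ne_zero, hv]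
    positivity
  set δ := √(k * ε ^ 2 / ℓ)
  have hδ : 0 < δ := sqrt_pos.2 (by positivity)
  have hδ2 : δ ^ 2 = k * ε ^ 2 / ℓ := sq_sqrt (by positivity)
  have hδγ : (δ ^ γ) ^ 2 = k ^ γ * ε ^ (2 * γ) / ℓ ^ γ := by
    rw [← rpow_natCast, ← rpow_mul hδ.le, mul_comm, rpow_mul hδ.le, rpow_natCast, hδ2,
      div_rpow (by positivity) hℓ.le, mul_rpow hk.le (by positivity), ← rpow_natCast ε,
      ← rpow_mul hε.le, Nat.cast_ofNat]
  have hδv : δ ^ 2 * v = 2 * ε ^ 2 := by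
    rw [hδ2, hv]
    simp only [k]
    field_simp
  have hE : rexp (C * v) = q ^ η := by
    rw [rpow_def_of_pos (by linarith), hv]
    congr 1
    field_simp
    rfl
  have hEs : q ^ η * Fintype.card (Fin d) ≤ (s : ℝ) ^ 2 := by
    rw [Fintype.card_fin, ← le_div_iff₀ hd0]
    exact rpow_le_self_of_one_le hq1.le hη1
  have hEp : q ^ η ≤ (s : ℝ) ^ (1 / γ) :=
    (rpow_le_rpow (by linarith) hqs hη.le).trans (rpow_le_rpow_of_exponent_le hs1 hηγ)
  obtain ⟨g, hg, H⟩ := hest v δ hv0 hδ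
  rw [hδv] at H
  refine ⟨fun y => ∑ i, g (y.1 i), by fun_prop, fun θ hθ => ?_⟩
  rw [integral_fun_fst (fun x : Fin d → ℝ => (∑ i, g (x i) - ∑ i, |θ i| ^ γ) ^ 2), probReal_univ,
    one_smul, integral_sq_sum_sub_eq (fun i => (H (θ i)).1)]
  set a : Fin d → ℝ := fun i => if 1 < γ then |θ i| ^ (γ - 1) else 0
  have ha : ∀ i, 0 ≤ a i := fun i => by
    simp only [a]
    split_ifs <;> positivity
  set N := (∑ i, |θ i| ^ γ) ^ (1 / γ)
  have hN : 0 ≤ N := by positivity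
  set A := if 1 < γ then N ^ (γ - 1) else 0
  have hθ' : (Finset.univ.filter fun i => |θ i| ≠ 0).card ≤ s := by simpa using hθ
  have ha₁ : ∑ i, a i ≤ (s : ℝ) ^ (1 / γ) * A := by
    by_cases h : 1 < γ
    · simpa only [a, A, h, if_true] using sum_rpow_sub_one_le h (fun i => abs_nonneg (θ i)) hθ'
    · simp [a, A, h]
  have ha₂ : ∑ i, a i ^ 2 ≤ (s : ℝ) ^ (1 / γ) * A ^ 2 := by
    by_cases h : 1 < γ
    · simpa only [a, A, h, if_true] using sum_sq_rpow_sub_one_le h (fun i => abs_nonneg (θ i)) hθ'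
    · simp [a, A, h]
  have hD : 0 ≤ δ ^ γ := rpow_nonneg hδ.le γ
  have hvar : ∑ i, Var[g; gaussianReal (θ i) (2 * ε ^ 2).toNNReal] ≤
      C * (2 * ((δ ^ γ) ^ 2 * (s : ℝ) ^ 2 + δ ^ 2 * ((s : ℝ) ^ (1 / γ) * A) ^ 2)) :=
    calc _ ≤ ∑ i, C * q ^ η * (δ ^ γ + δ * a i) ^ 2 := Finset.sum_le_sum fun i _ => by
          have := (H (θ i)).2.2
          rwa [hE, rpow_mul_incrementScale_div hδ] at this
      _ = C * (q ^ η * ∑ i, (δ ^ γ + δ * a i) ^ 2) := by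
          rw [← Finset.mul_sum, mul_assoc]
      _ ≤ _ := mul_le_mul_of_nonneg_left
          (mul_sum_sq_le_of_sum_sq_le (by positivity) hEp hEs ha₂) hC.le
  have hbias : (∑ i, (∫ y, g y ∂gaussianReal (θ i) (2 * ε ^ 2).toNNReal - |θ i| ^ γ)) ^ 2 ≤
      C ^ 2 * (2 * ((δ ^ γ) ^ 2 * (s : ℝ) ^ 2 + δ ^ 2 * ((s : ℝ) ^ (1 / γ) * A) ^ 2)) :=
    calc _ ≤ (C * ∑ i, if θ i = 0 then 0 else δ ^ γ + δ * a i) ^ 2 := by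
          rw [← sq_abs]
          refine pow_le_pow_left₀ (abs_nonneg _) ?_ 2
          rw [Finset.mul_sum]
          refine (Finset.abs_sum_le_sum_abs _ _).trans (Finset.sum_le_sum fun i _ => ?_)
          have := (H (θ i)).2.1
          rw [rpow_mul_incrementScale_div hδ] at this
          rwa [mul_ite, mul_zero]
      _ ≤ _ := by
          rw [mul_pow]
          exact mul_le_mul_of_nonneg_left
            (sq_sum_support_le_of_sum_le hD hδ.le ha hθ ha₁) (sq_nonneg C)
  have hA2 : ((s : ℝ) ^ (1 / γ) * A) ^ 2 =
      (s : ℝ) ^ (2 / γ) * N ^ (2 * γ - 2) * (if 1 < γ then (1 : ℝ) else 0) := by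
    have hsq : ∀ x p : ℝ, 0 ≤ x → (x ^ p) ^ 2 = x ^ (2 * p) := fun x p hx => by
      rw [← rpow_natCast, ← rpow_mul hx, mul_comm, Nat.cast_ofNat]
    rw [mul_pow, hsq _ _ (by positivity), mul_one_div, mul_assoc]
    congr 1
    simp only [A]
    split_ifs
    · rw [hsq _ _ hN, mul_one, mul_sub, mul_one]
    · simp
  rw [hA2, hδγ, hδ2] at hvar hbias
  set P := ε ^ (2 * γ) * (s : ℝ) ^ 2 / ℓ ^ γ
  set Q := ε ^ 2 * (s : ℝ) ^ (2 / γ) / ℓ * N ^ (2 * γ - 2) * (if 1 < γ then (1 : ℝ) else 0)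
  have hP : 0 ≤ P := by positivity
  have hQ : 0 ≤ Q := by
    simp only [Q]
    split_ifs <;> positivity
  calc _ ≤ 2 * (C ^ 2 + C) * (k ^ γ * P + k * Q) := by
        refine (add_le_add hvar hbias).trans_eq ?_
        simp only [P, Q]
        ring
    _ ≤ 2 * (C ^ 2 + C) * ((k ^ γ + k) * (P + Q)) := by
        have := rpow_nonneg hk.le γ
        gcongr
        nlinarith [mul_nonneg this hQ, mul_nonneg hk.le hP]
    _ = _ := by ring
end

section
/- Let γ ≥ 1 be an integer and ε > 0. For θ ∈ ℝ^d, let (y_{i,m})_{1≤i≤d, 1≤m≤γ} be mutually independent real random variables with y_{i,m} distributed as N(θ_i, γ ε²), and define the estimator Ñ_γ = Σ_{i=1}^d ∏_{m=1}^γ y_{i,m}. Then Ñ_γ is unbiased, E[Ñ_γ] = Σ_{i=1}^d θ_i^γ, and there exists a constant C > 0 depending only on γ such that for every θ ∈ ℝ^d, E[(Ñ_γ − Σ_{i=1}^d θ_i^γ)²] ≤ C ( ε^{2γ} d + ε² Σ_{i=1}^d |θ_i|^{2γ−2} ). -/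
open MeasureTheory ProbabilityTheory Real

section RowProducts

variable {ι κ : Type*} [Fintype ι] [Fintype κ]

/-- The product over one row of an array, written as a product over the whole array. -/
lemma prod_row_eq_prod_ite [DecidableEq ι] {M : Type*} [CommMonoid M] (f : ι × κ → M) (i : ι) :
    ∏ m, f (i, m) = ∏ p : ι × κ, if p.1 = i then f p else 1 := by
  rw [Fintype.prod_prod_type, Finset.prod_eq_single i]
  · simp
  · intro j _ hj
    simp [hj]
  · simp

variable {μ : ι × κ → Measure ℝ} [∀ p, IsProbabilityMeasure (μ p)]

lemma integrable_prod_row {g : ℝ → ℝ} {i : ι} (hg : ∀ m, Integrable g (μ (i, m))) :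
    Integrable (fun y : ι × κ → ℝ ↦ ∏ m, g (y (i, m))) (Measure.pi μ) := by
  classical
  have h := Integrable.fintype_prod (𝕜 := ℝ) (μ := μ)
    (f := fun p x ↦ if p.1 = i then g x else 1) ?_
  · refine h.congr (.of_forall fun y ↦ ?_)
    exact (prod_row_eq_prod_ite (fun p ↦ g (y p)) i).symm
  · rintro ⟨j, m⟩
    by_cases hj : j = i
    · subst hj
      simpa using hg m
    · simp [hj]

lemma integral_prod_row (g : ℝ → ℝ) (i : ι) :
    ∫ y : ι × κ → ℝ, ∏ m, g (y (i, m)) ∂Measure.pi μ = ∏ m, ∫ x, g x ∂μ (i, m) := by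
  classical
  have h := integral_fintype_prod_eq_prod (𝕜 := ℝ) (μ := μ)
    (fun (p : ι × κ) x ↦ if p.1 = i then g x else 1)
  rw [prod_row_eq_prod_ite (fun p ↦ ∫ x, g x ∂μ p) i]
  simp_rw [fun y : ι × κ → ℝ ↦ prod_row_eq_prod_ite (fun p ↦ g (y p)) i]
  rw [h]
  refine Finset.prod_congr rfl fun p _ ↦ ?_
  split_ifs <;> simp

lemma memLp_two_prod_row {i : ι} (hμ : ∀ m, MemLp id 2 (μ (i, m))) :
    MemLp (fun y : ι × κ → ℝ ↦ ∏ m, y (i, m)) 2 (Measure.pi μ) := by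
  have hmeas : Measurable fun y : ι × κ → ℝ ↦ ∏ m, y (i, m) := by fun_prop
  rw [memLp_two_iff_integrable_sq hmeas.aestronglyMeasurable]
  simp_rw [← Finset.prod_pow]
  exact integrable_prod_row fun m ↦ (hμ m).integrable_sq

lemma indepFun_prod_row {i j : ι} (hij : i ≠ j) :
    IndepFun (fun y : ι × κ → ℝ ↦ ∏ m, y (i, m)) (fun y ↦ ∏ m, y (j, m)) (Measure.pi μ) := by
  have hind : iIndepFun (fun (p : ι × κ) (y : ι × κ → ℝ) ↦ y p) (Measure.pi μ) :=
    iIndepFun_pi (X := fun _ ↦ id) fun _ ↦ aemeasurable_id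
  have hdisj : Disjoint (({i} : Finset ι) ×ˢ (Finset.univ : Finset κ))
      (({j} : Finset ι) ×ˢ (Finset.univ : Finset κ)) :=
    Finset.disjoint_product.2 (.inl (by simpa using hij))
  have h := hind.indepFun_finset _ _ hdisj fun p ↦ measurable_pi_apply p
  have hφ : Measurable fun z : ({i} ×ˢ Finset.univ : Finset (ι × κ)) → ℝ ↦
      ∏ m, z ⟨(i, m), by simp⟩ := by fun_prop
  have hψ : Measurable fun z : ({j} ×ˢ Finset.univ : Finset (ι × κ)) → ℝ ↦
      ∏ m, z ⟨(j, m), by simp⟩ := by fun_prop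
  exact h.comp hφ hψ

end RowProducts

lemma integral_sq_gaussianReal (m : ℝ) (v : NNReal) :
    ∫ x, x ^ 2 ∂gaussianReal m v = m ^ 2 + v := by
  have h := variance_eq_sub (memLp_id_gaussianReal (μ := m) (v := v) 2)
  simp only [variance_id_gaussianReal, id_eq, Pi.pow_apply, integral_id_gaussianReal] at h
  linarith

lemma add_pow_succ_sub_pow_succ_le {a b : ℝ} (ha : 0 ≤ a) (hb : 0 ≤ b) (k : ℕ) :
    (a + b) ^ (k + 1) - a ^ (k + 1) ≤ (k + 1) * b * (a + b) ^ k := by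
  induction k with
  | zero => simp
  | succ k ih =>
    have h : a ^ (k + 1) ≤ (a + b) ^ (k + 1) := by gcongr; linarith
    have h₁ := mul_le_mul_of_nonneg_right ih (add_nonneg ha hb)
    have h₂ := mul_le_mul_of_nonneg_left h hb
    push_cast
    calc (a + b) ^ (k + 1 + 1) - a ^ (k + 1 + 1)
        = ((a + b) ^ (k + 1) - a ^ (k + 1)) * (a + b) + b * a ^ (k + 1) := by ring
      _ ≤ (k + 1) * b * (a + b) ^ k * (a + b) + b * (a + b) ^ (k + 1) := add_le_add h₁ h₂
      _ = (k + 1 + 1) * b * (a + b) ^ (k + 1) := by ring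

lemma sq_add_mul_sq_pow_sub_le (k : ℕ) (t ε : ℝ) :
    (t ^ 2 + (k + 1) * ε ^ 2) ^ (k + 1) - (t ^ 2) ^ (k + 1) ≤
      ((k + 1) ^ 2 * 2 ^ k * (k + 1) ^ k : ℝ) *
        (ε ^ (2 * (k + 1)) + ε ^ 2 * |t| ^ (2 * k)) := by
  have hb : (0 : ℝ) ≤ (k + 1) * ε ^ 2 := by positivity
  have ht : |t| ^ (2 * k) = (t ^ 2) ^ k := by rw [pow_mul, sq_abs]
  have h2 : ((2 : ℝ)) ^ (k - 1) ≤ 2 ^ k := pow_le_pow_right₀ one_le_two (Nat.sub_le _ _)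
  have hk : (1 : ℝ) ≤ (k + 1) ^ k := one_le_pow₀ (by linarith [Nat.cast_nonneg (α := ℝ) k])
  have hpow : (t ^ 2 + (k + 1) * ε ^ 2) ^ k ≤
      2 ^ k * (k + 1) ^ k * ((t ^ 2) ^ k + (ε ^ 2) ^ k) := by
    calc (t ^ 2 + (k + 1) * ε ^ 2) ^ k
        ≤ 2 ^ (k - 1) * ((t ^ 2) ^ k + ((k + 1) * ε ^ 2) ^ k) := add_pow_le (sq_nonneg t) hb k
      _ ≤ 2 ^ k * ((k + 1) ^ k * (t ^ 2) ^ k + (k + 1) ^ k * (ε ^ 2) ^ k) := by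
          rw [mul_pow]
          gcongr
          exact le_mul_of_one_le_left (by positivity) hk
      _ = 2 ^ k * (k + 1) ^ k * ((t ^ 2) ^ k + (ε ^ 2) ^ k) := by ring
  calc (t ^ 2 + (k + 1) * ε ^ 2) ^ (k + 1) - (t ^ 2) ^ (k + 1)
      ≤ (k + 1) * ((k + 1) * ε ^ 2) * (t ^ 2 + (k + 1) * ε ^ 2) ^ k :=
        add_pow_succ_sub_pow_succ_le (sq_nonneg t) hb k
    _ ≤ (k + 1) * ((k + 1) * ε ^ 2) * (2 ^ k * (k + 1) ^ k * ((t ^ 2) ^ k + (ε ^ 2) ^ k)) := by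
        gcongr
    _ = _ := by rw [ht]; ring

/-- Theorem 2 (risk of the unbiased estimator based on `γ` independent cloned samples).
For an integer `γ ≥ 1` there is a constant `C > 0` depending only on `γ` such that for
every dimension `d`, noise level `ε > 0` and `θ ∈ ℝ^d`, if `(y_{i,m})` are mutually
independent with `y_{i,m} ~ N(θ_i, γ ε²)`, then the estimator
`Ñ_γ = ∑_i ∏_m y_{i,m}` is unbiased for `∑_i θ_i^γ` and its quadratic risk is bounded by
`C (ε^{2γ} d + ε² ∑_i |θ_i|^{2γ-2})`. -/
theorem risk_unbiased_estimator_integer_gamma (γ : ℕ) (hγ : 1 ≤ γ) :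
    ∃ C : ℝ, 0 < C ∧
      ∀ d : ℕ, ∀ ε : ℝ, 0 < ε → ∀ θ : Fin d → ℝ,
        (∫ y : Fin d × Fin γ → ℝ, (∑ i, ∏ m, y (i, m))
            ∂(Measure.pi fun p : Fin d × Fin γ =>
                gaussianReal (θ p.1) ((γ : ℝ) * ε ^ 2).toNNReal)
          = ∑ i, θ i ^ γ) ∧
        (∫ y : Fin d × Fin γ → ℝ, ((∑ i, ∏ m, y (i, m)) - ∑ i, θ i ^ γ) ^ 2
            ∂(Measure.pi fun p : Fin d × Fin γ =>
                gaussianReal (θ p.1) ((γ : ℝ) * ε ^ 2).toNNReal)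
          ≤ C * (ε ^ (2 * γ) * d + ε ^ 2 * ∑ i, |θ i| ^ (2 * γ - 2))) := by
  obtain ⟨k, rfl⟩ : ∃ k, γ = k + 1 := ⟨γ - 1, by omega⟩
  refine ⟨(k + 1) ^ 2 * 2 ^ k * (k + 1) ^ k, by positivity, fun d ε hε θ ↦ ?_⟩
  set v : NNReal := (((k + 1 : ℕ) : ℝ) * ε ^ 2).toNNReal with hv_def
  have hv : (v : ℝ) = (k + 1) * ε ^ 2 := by
    rw [hv_def, Real.coe_toNNReal _ (by positivity)]
    push_cast
    rfl
  set P := Measure.pi fun p : Fin d × Fin (k + 1) ↦ gaussianReal (θ p.1) v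
  have hL (i : Fin d) : MemLp (fun y : Fin d × Fin (k + 1) → ℝ ↦ ∏ m, y (i, m)) 2 P :=
    memLp_two_prod_row fun _ ↦ memLp_id_gaussianReal 2
  have hmean (i : Fin d) : ∫ y, ∏ m, y (i, m) ∂P = θ i ^ (k + 1) := by
    have h := integral_prod_row (μ := fun p : Fin d × Fin (k + 1) ↦ gaussianReal (θ p.1) v) id i
    simpa [integral_id_gaussianReal] using h
  have hsq (i : Fin d) : ∫ y, (∏ m, y (i, m)) ^ 2 ∂P = (θ i ^ 2 + (k + 1) * ε ^ 2) ^ (k + 1) := by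
    have h := integral_prod_row (μ := fun p : Fin d × Fin (k + 1) ↦ gaussianReal (θ p.1) v)
      (fun x ↦ x ^ 2) i
    simpa [integral_sq_gaussianReal, hv, Finset.prod_pow] using h
  have hvar (i : Fin d) : Var[fun y ↦ ∏ m, y (i, m); P] =
      (θ i ^ 2 + (k + 1) * ε ^ 2) ^ (k + 1) - (θ i ^ 2) ^ (k + 1) := by
    rw [variance_eq_sub (hL i)]
    simp only [Pi.pow_apply]
    rw [hsq, hmean]
    ring
  have hunbiased : ∫ y, ∑ i, ∏ m, y (i, m) ∂P = ∑ i, θ i ^ (k + 1) := by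
    rw [integral_finsetSum _ fun i _ ↦ (hL i).integrable one_le_two]
    simp_rw [hmean]
  refine ⟨hunbiased, ?_⟩
  have hrisk : ∫ y, ((∑ i, ∏ m, y (i, m)) - ∑ i, θ i ^ (k + 1)) ^ 2 ∂P =
      ∑ i, Var[fun y ↦ ∏ m, y (i, m); P] := by
    rw [← hunbiased, ← variance_eq_integral
      (memLp_finsetSum Finset.univ fun i _ ↦ hL i).aemeasurable,
      ← IndepFun.variance_sum (fun i _ ↦ hL i) fun i _ j _ hij ↦ indepFun_prod_row hij]
    congr 1
    ext y
    simp
  rw [hrisk]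
  calc ∑ i, Var[fun y ↦ ∏ m, y (i, m); P]
      ≤ ∑ i, ((k + 1) ^ 2 * 2 ^ k * (k + 1) ^ k : ℝ) *
          (ε ^ (2 * (k + 1)) + ε ^ 2 * |θ i| ^ (2 * k)) :=
        Finset.sum_le_sum fun i _ ↦ (hvar i).trans_le (sq_add_mul_sq_pow_sub_le k (θ i) ε)
    _ = _ := by
        rw [← Finset.mul_sum, Finset.sum_add_distrib, ← Finset.mul_sum,
          show 2 * (k + 1) - 2 = 2 * k by omega]
        simp [mul_comm]
end

section
/- Let d, s be integers with 1 ≤ s ≤ d and s² ≥ 4d, let ε > 0 and γ > 1. Then there exist a constant C > 0 depending only on γ and a Borel measurable function T : ℝ^d × ℝ^d → ℝ such that for every θ ∈ B_0(s) the following holds: if (y_{1,1},…,y_{1,d}, y_{2,1},…,y_{2,d}) are mutually independent real random variables with y_{j,i} distributed as N(θ_i, 2ε²) for j = 1,2 and i = 1,…,d, then E[(T(y_{1,·}, y_{2,·}) − ‖θ‖_γ)²] ≤ C ε² s^{2/γ} / log(s²/d). -/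
open MeasureTheory ProbabilityTheory Real

theorem norm_pow_succ_sub_pow_succ_le (k : ℕ) {a b : ℂ} {M : ℝ} (ha : ‖a‖ ≤ M) (hb : ‖b‖ ≤ M) :
    ‖a ^ (k + 1) - b ^ (k + 1)‖ ≤ (k + 1) * ‖a - b‖ * M ^ k := by
  have hM : 0 ≤ M := (norm_nonneg a).trans ha
  induction k with
  | zero => simp
  | succ k ih =>
    have h : a ^ (k + 1 + 1) - b ^ (k + 1 + 1)
        = a * (a ^ (k + 1) - b ^ (k + 1)) + (a - b) * b ^ (k + 1) := by ring
    rw [h]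
    calc _ ≤ ‖a‖ * ‖a ^ (k + 1) - b ^ (k + 1)‖ + ‖a - b‖ * ‖b‖ ^ (k + 1) := by
          refine (norm_add_le _ _).trans ?_
          rw [norm_mul, norm_mul, norm_pow]
      _ ≤ M * ((k + 1) * ‖a - b‖ * M ^ k) + ‖a - b‖ * M ^ (k + 1) := by gcongr
      _ = _ := by push_cast; ring

theorem norm_cexp_sub_one_le (z : ℂ) : ‖Complex.exp z - 1‖ ≤ ‖z‖ * rexp ‖z‖ := by
  simpa using Complex.norm_exp_sub_sum_le_norm_mul_exp z 1

theorem norm_sin_add_sub_sin_le (x : ℝ) (u : ℂ) :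
    ‖Complex.sin (x + u) - Complex.sin x‖ ≤ ‖u‖ * rexp ‖u‖ := by
  have h : Complex.sin (x + u) - Complex.sin x
      = (Complex.exp ((-x : ℝ) * Complex.I) * (Complex.exp (-u * Complex.I) - 1)
        - Complex.exp (x * Complex.I) * (Complex.exp (u * Complex.I) - 1)) * (Complex.I / 2) := by
    simp only [Complex.sin, mul_sub, ← Complex.exp_add, Complex.ofReal_neg, neg_add, add_mul]
    ring
  have h₁ := norm_cexp_sub_one_le (-u * Complex.I)
  have h₂ := norm_cexp_sub_one_le (u * Complex.I)
  simp only [norm_mul, norm_neg, Complex.norm_I, mul_one] at h₁ h₂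
  rw [h, norm_mul]
  have h₃ : ‖Complex.I / 2‖ = 1 / 2 := by simp
  rw [h₃]
  have h₄ := norm_sub_le
    (Complex.exp ((-x : ℝ) * Complex.I) * (Complex.exp (-u * Complex.I) - 1))
    (Complex.exp (x * Complex.I) * (Complex.exp (u * Complex.I) - 1))
  rw [norm_mul, norm_mul, Complex.norm_exp_ofReal_mul_I, Complex.norm_exp_ofReal_mul_I] at h₄
  linarith

theorem norm_sin_ofReal_le (x : ℝ) : ‖Complex.sin x‖ ≤ min 1 |x| := by
  rw [← Complex.ofReal_sin, Complex.norm_real, Real.norm_eq_abs]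
  exact le_min (Real.abs_sin_le_one x) (Real.abs_sin_le_abs)

theorem norm_sin_add_le (x : ℝ) (u : ℂ) :
    ‖Complex.sin (x + u)‖ ≤ min 1 (|x| + ‖u‖) * rexp (2 * ‖u‖) := by
  have h₁ := norm_sin_add_sub_sin_le x u
  have h₂ := norm_le_norm_add_norm_sub' (Complex.sin (x + u)) (Complex.sin x)
  have h₃ := norm_sin_ofReal_le x
  have hu := norm_nonneg u
  have he : 1 ≤ rexp ‖u‖ := Real.one_le_exp hu
  have he' := Real.add_one_le_exp ‖u‖
  have hx := abs_nonneg x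
  have e2 : rexp (2 * ‖u‖) = rexp ‖u‖ * rexp ‖u‖ := by rw [← Real.exp_add]; ring_nf
  have h₅ := h₃.trans (min_le_left _ _)
  have h₆ := h₃.trans (min_le_right _ _)
  rcases min_cases 1 (|x| + ‖u‖) with ⟨h, -⟩ | ⟨h, -⟩ <;> rw [h, e2]
  · nlinarith
  · have : 1 ≤ rexp ‖u‖ * rexp ‖u‖ := by nlinarith
    have : rexp ‖u‖ ≤ rexp ‖u‖ * rexp ‖u‖ := by nlinarith
    nlinarith

theorem norm_sin_pow_add_sub_le (k : ℕ) (x : ℝ) (u : ℂ) :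
    ‖Complex.sin (x + u) ^ (k + 1) - Complex.sin x ^ (k + 1)‖
      ≤ (k + 1) * ‖u‖ * min 1 (|x| + ‖u‖) ^ k * rexp (2 * (k + 1) * ‖u‖) := by
  have hu := norm_nonneg u
  have hm : 0 ≤ min 1 (|x| + ‖u‖) := by positivity
  have he : 1 ≤ rexp (2 * ‖u‖) := Real.one_le_exp (by positivity)
  have h₁ : ‖Complex.sin x‖ ≤ min 1 (|x| + ‖u‖) * rexp (2 * ‖u‖) := by
    refine (norm_sin_ofReal_le x).trans ?_
    have : min 1 |x| ≤ min 1 (|x| + ‖u‖) := min_le_min le_rfl (by linarith)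
    nlinarith
  refine (norm_pow_succ_sub_pow_succ_le k (norm_sin_add_le x u) h₁).trans ?_
  have h₂ : ‖Complex.sin (x + u) - Complex.sin x‖ ≤ ‖u‖ * rexp (2 * ‖u‖) :=
    (norm_sin_add_sub_sin_le x u).trans (by gcongr; linarith)
  calc _ ≤ (k + 1) * (‖u‖ * rexp (2 * ‖u‖)) * (min 1 (|x| + ‖u‖) * rexp (2 * ‖u‖)) ^ k := by
        gcongr
    _ = (k + 1) * ‖u‖ * min 1 (|x| + ‖u‖) ^ k * rexp (2 * ‖u‖) ^ (k + 1) := by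
        rw [mul_pow]; ring
    _ = _ := by
        rw [← Real.exp_nat_mul]; push_cast; ring_nf

theorem integrableOn_min_pow_mul_rpow {k : ℕ} {a : ℝ} (ha : 1 < a) (hk : a < k + 1) :
    IntegrableOn (fun t : ℝ => min 1 t ^ k * t ^ (-a)) (Set.Ioi 0) := by
  rw [← Set.Ioc_union_Ioi_eq_Ioi zero_le_one]
  refine IntegrableOn.union ?_ ?_
  · have h : IntegrableOn (fun t : ℝ => t ^ ((k : ℝ) - a)) (Set.Ioc 0 1) :=
      (intervalIntegral.intervalIntegrable_rpow' (by linarith)).1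
    refine h.congr_fun (fun t ht => ?_) measurableSet_Ioc
    simp only [min_eq_right ht.2]
    rw [← Real.rpow_natCast, ← Real.rpow_add ht.1]
    rfl
  · refine (integrableOn_Ioi_rpow_of_lt (a := -a) (by linarith) one_pos).congr_fun
      (fun t ht => ?_) measurableSet_Ioi
    simp only [min_eq_left (le_of_lt (Set.mem_Ioi.1 ht)), one_pow, one_mul]

theorem setIntegral_Ioi_comp_mul_mul_rpow (f : ℝ → ℝ) (a : ℝ) {R : ℝ} (hR : 0 < R) :
    ∫ t in Set.Ioi 0, f (t * R) * t ^ (-a)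
      = R ^ (a - 1) * ∫ t in Set.Ioi 0, f t * t ^ (-a) := by
  have h := integral_comp_mul_left_Ioi (fun t => f t * t ^ (-a)) 0 hR
  rw [mul_zero, smul_eq_mul] at h
  have h' : ∫ t in Set.Ioi 0, f (t * R) * t ^ (-a)
      = R ^ a * ∫ t in Set.Ioi 0, f (R * t) * (R * t) ^ (-a) := by
    rw [← integral_const_mul]
    refine setIntegral_congr_fun measurableSet_Ioi fun t ht => ?_
    have : R ^ a * R ^ (-a) = 1 := by rw [← Real.rpow_add hR]; simp
    simp only [Real.mul_rpow hR.le (le_of_lt (Set.mem_Ioi.1 ht)), mul_comm t R]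
    linear_combination (-f (R * t) * t ^ (-a)) * this
  rw [h', h, ← mul_assoc, Real.rpow_sub_one hR.ne']
  ring

theorem integrableOn_Ioi_comp_mul_mul_rpow {f : ℝ → ℝ} {a R : ℝ} (hR : 0 < R)
    (hf : IntegrableOn (fun t => f t * t ^ (-a)) (Set.Ioi 0)) :
    IntegrableOn (fun t => f (t * R) * t ^ (-a)) (Set.Ioi 0) := by
  have h := (integrableOn_Ioi_comp_mul_left_iff (fun t => f t * t ^ (-a)) 0 hR).2
    (by simpa using hf)
  have h' : IntegrableOn (fun t => R ^ a * (f (R * t) * (R * t) ^ (-a))) (Set.Ioi 0) :=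
    h.const_mul (R ^ a)
  refine h'.congr_fun (fun t ht => ?_) measurableSet_Ioi
  have : R ^ a * R ^ (-a) = 1 := by rw [← Real.rpow_add hR]; simp
  simp only [Real.mul_rpow hR.le (le_of_lt (Set.mem_Ioi.1 ht)), mul_comm t R]
  linear_combination (f (R * t) * t ^ (-a)) * this

/-- The constant `∫₀^∞ sin(t)^(k+1) t^(-(1+γ)) dt`. -/
noncomputable def sinPowConst (k : ℕ) (γ : ℝ) : ℝ :=
  ∫ t in Set.Ioi (0 : ℝ), Real.sin t ^ (k + 1) * t ^ (-(1 + γ))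

/-- The band-limited entire function `∫₀^T sin(tz)^(k+1) t^(-(1+γ)) dt` (its real part). -/
noncomputable def sinPowTrunc (k : ℕ) (γ T : ℝ) (z : ℂ) : ℝ :=
  ∫ t in Set.Ioc 0 T, (Complex.sin (t * z) ^ (k + 1)).re * t ^ (-(1 + γ))

theorem integrableOn_sin_pow_mul_rpow {k : ℕ} {γ : ℝ} (hγ : 0 < γ) (hk : γ ≤ k) :
    IntegrableOn (fun t : ℝ => Real.sin t ^ (k + 1) * t ^ (-(1 + γ))) (Set.Ioi 0) := by
  have h := integrableOn_min_pow_mul_rpow (k := k + 1) (a := 1 + γ) (by linarith)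
    (by push_cast; linarith)
  refine h.mono' (by fun_prop) ?_
  filter_upwards [ae_restrict_mem measurableSet_Ioi] with t ht
  have ht' : 0 < t := ht
  rw [norm_mul, norm_pow, Real.norm_eq_abs, Real.norm_of_nonneg (Real.rpow_nonneg ht'.le _)]
  have h₁ : |Real.sin t| ≤ min 1 t := by
    refine le_min (Real.abs_sin_le_one t) ?_
    simpa [abs_of_pos ht'] using Real.abs_sin_le_abs (x := t)
  gcongr

theorem sinPowConst_pos {k : ℕ} {γ : ℝ} (hγ : 0 < γ) (hk : γ ≤ k) (hev : Even (k + 1)) :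
    0 < sinPowConst k γ := by
  rw [sinPowConst, setIntegral_pos_iff_support_of_nonneg_ae]
  · refine lt_of_lt_of_le ?_ (measure_mono (s := Set.Ioo (0 : ℝ) 1) ?_)
    · simp
    · intro t ht
      refine ⟨?_, ht.1⟩
      have h₁ : 0 < Real.sin t := 
        Real.sin_pos_of_pos_of_lt_pi ht.1 (by linarith [ht.2, Real.pi_gt_three])
      have h₂ : 0 < t ^ (-(1 + γ)) := Real.rpow_pos_of_pos ht.1 _
      exact (mul_pos (pow_pos h₁ _) h₂).ne'
  · filter_upwards [ae_restrict_mem measurableSet_Ioi] with t ht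
    have ht' : 0 < t := ht
    exact mul_nonneg (hev.pow_nonneg _) (Real.rpow_nonneg ht'.le _)
  · exact integrableOn_sin_pow_mul_rpow hγ hk

theorem sinPowTrunc_zero (k : ℕ) (γ T : ℝ) : sinPowTrunc k γ T 0 = 0 := by
  simp [sinPowTrunc]

theorem sinPowTrunc_ofReal (k : ℕ) (γ T x : ℝ) :
    sinPowTrunc k γ T x = ∫ t in Set.Ioc 0 T, Real.sin (t * x) ^ (k + 1) * t ^ (-(1 + γ)) := by
  refine integral_congr_ae (Filter.Eventually.of_forall fun t => ?_)
  simp only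
  rw [← Complex.ofReal_mul, ← Complex.ofReal_sin, ← Complex.ofReal_pow, Complex.ofReal_re]

theorem abs_sinPowTrunc_sub_le {k : ℕ} {γ T : ℝ} (hγ : 0 < γ) (hk : γ ≤ k) (hev : Even (k + 1))
    (hT : 0 < T) (x : ℝ) :
    |sinPowTrunc k γ T x - sinPowConst k γ * |x| ^ γ| ≤ T ^ (-γ) / γ := by
  have hsin : ∀ t, Real.sin (t * x) ^ (k + 1) = Real.sin (t * |x|) ^ (k + 1) := by
    intro t
    rcases abs_choice x with h | h <;> rw [h]
    rw [mul_neg, Real.sin_neg, hev.neg_pow]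
  rw [sinPowTrunc_ofReal]
  simp only [hsin]
  rcases (abs_nonneg x).eq_or_lt with hx | hx
  · rw [← hx]
    simp [Real.zero_rpow hγ.ne']
    positivity
  have hint := integrableOn_Ioi_comp_mul_mul_rpow (f := fun t => Real.sin t ^ (k + 1)) hx
    (integrableOn_sin_pow_mul_rpow hγ hk)
  have hfull := setIntegral_Ioi_comp_mul_mul_rpow (fun t => Real.sin t ^ (k + 1)) (1 + γ) hx
  rw [add_sub_cancel_left] at hfull
  rw [sinPowConst, mul_comm, ← hfull, ← Set.Ioc_union_Ioi_eq_Ioi hT.le,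
    setIntegral_union Set.Ioc_disjoint_Ioi_same measurableSet_Ioi
      (hint.mono_set Set.Ioc_subset_Ioi_self) (hint.mono_set (Set.Ioi_subset_Ioi hT.le)),
    sub_add_cancel_left, abs_neg]
  have htail := integral_Ioi_rpow_of_lt (a := -(1 + γ)) (by linarith) hT
  have e : T ^ (-γ) / γ = ∫ t in Set.Ioi T, t ^ (-(1 + γ)) := by
    rw [htail, show -(1 + γ) + 1 = -γ by ring, neg_div_neg_eq]
  rw [e, ← Real.norm_eq_abs]
  refine norm_integral_le_of_norm_le (integrableOn_Ioi_rpow_of_lt (by linarith) hT) ?_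
  filter_upwards [ae_restrict_mem measurableSet_Ioi] with t ht
  have ht' : 0 < t := hT.trans ht
  rw [norm_mul, norm_pow, Real.norm_eq_abs, Real.norm_of_nonneg (Real.rpow_nonneg ht'.le _)]
  exact mul_le_of_le_one_left (Real.rpow_nonneg ht'.le _)
    (pow_le_one₀ (abs_nonneg _) (Real.abs_sin_le_one _))

theorem norm_sin_pow_mul_rpow_le {k : ℕ} {γ T : ℝ} (hk : γ ≤ k) {t : ℝ} (ht : t ∈ Set.Ioc 0 T)
    (z : ℂ) :
    ‖Complex.sin (t * z) ^ (k + 1)‖ * t ^ (-(1 + γ))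
      ≤ T ^ (k - γ) * (‖z‖ * rexp (T * ‖z‖)) ^ (k + 1) := by
  have h₁ := norm_sin_add_sub_sin_le 0 (t * z)
  simp only [Complex.ofReal_zero, zero_add, Complex.sin_zero, sub_zero, norm_mul, Complex.norm_real,
    Real.norm_of_nonneg ht.1.le] at h₁
  have h₂ : rexp (t * ‖z‖) ≤ rexp (T * ‖z‖) := by
    gcongr
    exact ht.2
  have ht₀ := ht.1
  have h₃ : ‖Complex.sin (t * z)‖ ≤ t * (‖z‖ * rexp (T * ‖z‖)) :=
    h₁.trans (by rw [mul_assoc]; gcongr)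
  have h₄ : t ^ (k + 1) * t ^ (-(1 + γ)) = t ^ (k - γ) := by
    rw [← Real.rpow_natCast, ← Real.rpow_add ht₀]
    push_cast
    ring_nf
  calc _ ≤ (t * (‖z‖ * rexp (T * ‖z‖))) ^ (k + 1) * t ^ (-(1 + γ)) := by
        rw [norm_pow]
        gcongr
    _ = t ^ (k - γ) * (‖z‖ * rexp (T * ‖z‖)) ^ (k + 1) := by rw [← h₄, mul_pow]; ring
    _ ≤ _ := by
        gcongr
        exact ht.2

theorem norm_re_sin_pow_mul_rpow_le {k : ℕ} {γ T : ℝ} (hk : γ ≤ k) {t : ℝ}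
    (ht : t ∈ Set.Ioc 0 T) (z : ℂ) :
    ‖(Complex.sin (t * z) ^ (k + 1)).re * t ^ (-(1 + γ))‖
      ≤ T ^ (k - γ) * (‖z‖ * rexp (T * ‖z‖)) ^ (k + 1) := by
  refine le_trans ?_ (norm_sin_pow_mul_rpow_le hk ht z)
  rw [norm_mul, Real.norm_of_nonneg (Real.rpow_nonneg ht.1.le _)]
  have := Complex.abs_re_le_norm (Complex.sin (t * z) ^ (k + 1))
  have h := Real.rpow_nonneg ht.1.le (-(1 + γ))
  exact mul_le_mul_of_nonneg_right this h

theorem integrableOn_re_sin_pow_mul_rpow {k : ℕ} {γ : ℝ} (hk : γ ≤ k) (T : ℝ) (z : ℂ) :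
    IntegrableOn (fun t : ℝ => (Complex.sin (t * z) ^ (k + 1)).re * t ^ (-(1 + γ)))
      (Set.Ioc 0 T) := by
  refine Integrable.mono' (integrable_const (T ^ (k - γ) * (‖z‖ * rexp (T * ‖z‖)) ^ (k + 1)))
    (by fun_prop) ?_
  filter_upwards [ae_restrict_mem measurableSet_Ioc] with t ht
  exact norm_re_sin_pow_mul_rpow_le hk ht z

/-- The constant `∫₀^∞ min(1,t)^k t^(-γ) dt`. -/
noncomputable def minPowConst (k : ℕ) (γ : ℝ) : ℝ :=
  ∫ t in Set.Ioi (0 : ℝ), min 1 t ^ k * t ^ (-γ)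

theorem minPowConst_nonneg (k : ℕ) (γ : ℝ) : 0 ≤ minPowConst k γ := by
  refine setIntegral_nonneg measurableSet_Ioi fun t ht => ?_
  have ht' : 0 < t := ht
  positivity

theorem abs_sinPowTrunc_add_sub_le {k : ℕ} {γ T : ℝ} (hγ : 1 < γ) (hk : γ ≤ k) (x : ℝ) (w : ℂ) :
    |sinPowTrunc k γ T (x + w) - sinPowTrunc k γ T x|
      ≤ (k + 1) * minPowConst k γ * ‖w‖ * rexp (2 * (k + 1) * T * ‖w‖)
        * (|x| + ‖w‖) ^ (γ - 1) := by
  rcases (norm_nonneg w).eq_or_lt with hw | hw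
  · rw [eq_comm, norm_eq_zero] at hw
    simp [hw]
  have hR : 0 < |x| + ‖w‖ := by positivity
  have hbase := integrableOn_min_pow_mul_rpow (k := k) hγ (by linarith)
  have hint := integrableOn_Ioi_comp_mul_mul_rpow (f := fun t => min 1 t ^ k) hR hbase
  have hval := setIntegral_Ioi_comp_mul_mul_rpow (fun t => min 1 t ^ k) γ hR
  set c := (k + 1) * ‖w‖ * rexp (2 * (k + 1) * T * ‖w‖) with hc
  have hc₀ : 0 ≤ c := by positivity
  have hint' := (hint.mono_set (Set.Ioc_subset_Ioi_self : Set.Ioc 0 T ⊆ _)).const_mul c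
  rw [sinPowTrunc, sinPowTrunc, ← integral_sub (integrableOn_re_sin_pow_mul_rpow hk T _)
    (integrableOn_re_sin_pow_mul_rpow hk T _), ← Real.norm_eq_abs]
  refine (norm_integral_le_of_norm_le hint' ?_).trans ?_
  · filter_upwards [ae_restrict_mem measurableSet_Ioc] with t ht
    have ht₀ := ht.1
    have h₁ := norm_sin_pow_add_sub_le k (t * x) (t * w)
    have h₂ := (Complex.abs_re_le_norm _).trans h₁
    rw [Complex.sub_re, abs_mul, norm_mul, Complex.norm_real, Real.norm_of_nonneg ht₀.le,
      abs_of_pos ht₀, Complex.ofReal_mul, ← mul_add, ← mul_add] at h₂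
    have h₃ : rexp (2 * (k + 1) * (t * ‖w‖)) ≤ rexp (2 * (k + 1) * T * ‖w‖) := by
      rw [mul_assoc _ T]
      gcongr
      exact ht.2
    rw [← sub_mul, norm_mul, Real.norm_eq_abs, Real.norm_of_nonneg (Real.rpow_nonneg ht₀.le _)]
    have h₄ : t * t ^ (-(1 + γ)) = t ^ (-γ) := by
      rw [← Real.rpow_one_add' ht₀.le (by linarith)]
      ring_nf
    calc _ ≤ ((k + 1) * (t * ‖w‖) * min 1 (t * (|x| + ‖w‖)) ^ k
            * rexp (2 * (k + 1) * T * ‖w‖)) * t ^ (-(1 + γ)) := by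
          have := Real.rpow_nonneg ht₀.le (-(1 + γ))
          refine mul_le_mul_of_nonneg_right (h₂.trans ?_) this
          gcongr
      _ = _ := by rw [hc, ← h₄]; ring
  · rw [integral_const_mul]
    have h₅ : ∫ t in Set.Ioc 0 T, min 1 (t * (|x| + ‖w‖)) ^ k * t ^ (-γ)
        ≤ (|x| + ‖w‖) ^ (γ - 1) * minPowConst k γ := by
      rw [minPowConst, ← hval]
      refine setIntegral_mono_set hint ?_ (Filter.Eventually.of_forall Set.Ioc_subset_Ioi_self)
      filter_upwards [ae_restrict_mem measurableSet_Ioi] with t ht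
      have ht' : 0 < t := ht
      show 0 ≤ min 1 (t * (|x| + ‖w‖)) ^ k * t ^ (-γ)
      positivity
    calc _ ≤ c * ((|x| + ‖w‖) ^ (γ - 1) * minPowConst k γ) := by gcongr
      _ = _ := by rw [hc]; ring

theorem integrable_cexp_mul_gaussianReal (θ : ℝ) (v : NNReal) (b : ℂ) :
    Integrable (fun y : ℝ => Complex.exp (b * y)) (gaussianReal θ v) := by
  refine (integrable_exp_mul_gaussianReal b.re).mono' (by fun_prop) ?_
  refine Filter.Eventually.of_forall fun y => ?_
  simp [Complex.norm_exp]

/-- The complex combination of two samples that has the law `θ + ε(Z + iZ')`. -/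
noncomputable def complexPair (y : ℝ × ℝ) : ℂ :=
  ((y.1 + y.2) / 2 : ℝ) + ((y.1 - y.2) / 2 : ℝ) * Complex.I

theorem continuous_complexPair : Continuous complexPair := by
  unfold complexPair
  fun_prop

theorem cexp_mul_complexPair (b : ℂ) (y : ℝ × ℝ) :
    Complex.exp (b * complexPair y)
      = Complex.exp (b * (1 + Complex.I) / 2 * y.1) * Complex.exp (b * (1 - Complex.I) / 2 * y.2) := by
  rw [← Complex.exp_add, complexPair]
  push_cast
  ring_nf

theorem integrable_cexp_mul_complexPair (θ : ℝ) (v : NNReal) (b : ℂ) :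
    Integrable (fun y => Complex.exp (b * complexPair y))
      ((gaussianReal θ v).prod (gaussianReal θ v)) := by
  simp only [cexp_mul_complexPair]
  exact (integrable_cexp_mul_gaussianReal θ v _).mul_prod (integrable_cexp_mul_gaussianReal θ v _)

theorem integral_cexp_mul_complexPair (θ : ℝ) (v : NNReal) (b : ℂ) :
    ∫ y, Complex.exp (b * complexPair y) ∂((gaussianReal θ v).prod (gaussianReal θ v))
      = Complex.exp (b * θ) := by
  have h (c : ℂ) : ∫ y : ℝ, Complex.exp (c * y) ∂(gaussianReal θ v)
      = Complex.exp (c * θ + v * c ^ 2 / 2) := complexMGF_id_gaussianReal c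
  simp only [cexp_mul_complexPair]
  rw [integral_prod_mul (fun y : ℝ => Complex.exp (b * (1 + Complex.I) / 2 * y))
    (fun y : ℝ => Complex.exp (b * (1 - Complex.I) / 2 * y)), h, h, ← Complex.exp_add]
  congr 1
  linear_combination (v * b ^ 2 / 4) * Complex.I_sq

theorem sin_pow_eq_sum_cexp (n : ℕ) (z : ℂ) :
    Complex.sin z ^ n = ∑ j ∈ Finset.range (n + 1),
      (Complex.I / 2) ^ n * (-1) ^ (n - j) * n.choose j
        * Complex.exp (((n - j : ℕ) - j : ℂ) * Complex.I * z) := by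
  have h : Complex.sin z
      = (Complex.exp (-z * Complex.I) + -Complex.exp (z * Complex.I)) * (Complex.I / 2) := by
    rw [Complex.sin]
    ring
  rw [h, mul_pow, add_pow, Finset.sum_mul]
  refine Finset.sum_congr rfl fun j _ => ?_
  rw [neg_pow (Complex.exp (z * Complex.I)), ← Complex.exp_nat_mul, ← Complex.exp_nat_mul,
    show ((n - j : ℕ) - j : ℂ) * Complex.I * z
      = j * (-z * Complex.I) + (n - j : ℕ) * (z * Complex.I) by ring, Complex.exp_add]
  ring

theorem integral_re_sin_pow_complexPair (n : ℕ) (θ t : ℝ) (v : NNReal) :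
    ∫ y, (Complex.sin (t * complexPair y) ^ n).re ∂((gaussianReal θ v).prod (gaussianReal θ v))
      = (Complex.sin (t * θ) ^ n).re := by
  have hexp : ∀ (b : ℂ) (y : ℝ × ℝ), Complex.exp (b * (t * complexPair y))
      = Complex.exp (b * t * complexPair y) := fun b y => by ring_nf
  have hint : Integrable (fun y => Complex.sin (t * complexPair y) ^ n)
      ((gaussianReal θ v).prod (gaussianReal θ v)) := by
    simp only [sin_pow_eq_sum_cexp, hexp]
    exact integrable_finsetSum _ fun j _ => (integrable_cexp_mul_complexPair θ v _).const_mul _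
  have h := integral_re hint
  simp only [RCLike.re_to_complex] at h
  rw [h]
  congr 1
  simp only [sin_pow_eq_sum_cexp, hexp]
  rw [integral_finsetSum _ fun j _ => (integrable_cexp_mul_complexPair θ v _).const_mul _]
  simp only [integral_const_mul, integral_cexp_mul_complexPair]
  simp only [mul_assoc]

theorem integral_exp_mul_abs_sub_gaussianReal_le (θ : ℝ) (v : NNReal) (c : ℝ) :
    Integrable (fun y => rexp (c * |y - θ|)) (gaussianReal θ v) ∧
      ∫ y, rexp (c * |y - θ|) ∂(gaussianReal θ v) ≤ 2 * rexp (v * c ^ 2 / 2) := by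
  have hi (c : ℝ) : Integrable (fun y => rexp (c * (y - θ))) (gaussianReal θ v) := by
    have h := (integrable_exp_mul_gaussianReal (μ := θ) (v := v) c).const_mul (rexp (-(c * θ)))
    refine h.congr (Filter.Eventually.of_forall fun y => ?_)
    simp only [← Real.exp_add]
    ring_nf
  have hv (c : ℝ) : ∫ y, rexp (c * (y - θ)) ∂(gaussianReal θ v) = rexp (v * c ^ 2 / 2) := by
    have h := congrFun (mgf_fun_id_gaussianReal (μ := θ) (v := v)) c
    simp only [mgf] at h
    have h' : ∀ y, rexp (c * (y - θ)) = rexp (-(c * θ)) * rexp (c * y) := fun y => by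
      rw [← Real.exp_add]; ring_nf
    simp only [h', integral_const_mul, h]
    rw [← Real.exp_add]
    ring_nf
  have hle (y : ℝ) : rexp (c * |y - θ|) ≤ rexp (c * (y - θ)) + rexp (-c * (y - θ)) := by
    have h₁ := Real.exp_pos (c * (y - θ))
    have h₂ := Real.exp_pos (-c * (y - θ))
    rcases abs_choice (y - θ) with h | h <;> rw [h]
    · linarith
    · rw [mul_neg, ← neg_mul]; linarith
  have hsum := (hi c).add (hi (-c))
  have hint : Integrable (fun y => rexp (c * |y - θ|)) (gaussianReal θ v) := by
    refine hsum.mono' (by fun_prop) (Filter.Eventually.of_forall fun y => ?_)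
    rw [Real.norm_of_nonneg (Real.exp_pos _).le]
    exact hle y
  refine ⟨hint, (integral_mono hint hsum hle).trans ?_⟩
  rw [integral_add' (hi c) (hi (-c)), hv, hv, neg_sq, two_mul]

theorem integral_exp_mul_abs_sub_prod_le (θ : ℝ) (v : NNReal) (c : ℝ) :
    Integrable (fun y : ℝ × ℝ => rexp (c * (|y.1 - θ| + |y.2 - θ|)))
        ((gaussianReal θ v).prod (gaussianReal θ v)) ∧
      ∫ y : ℝ × ℝ, rexp (c * (|y.1 - θ| + |y.2 - θ|))
        ∂((gaussianReal θ v).prod (gaussianReal θ v)) ≤ 4 * rexp (v * c ^ 2) := by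
  obtain ⟨h₁, h₂⟩ := integral_exp_mul_abs_sub_gaussianReal_le θ v c
  simp only [mul_add, Real.exp_add]
  refine ⟨h₁.mul_prod h₁, ?_⟩
  rw [integral_prod_mul (fun y : ℝ => rexp (c * |y - θ|)) (fun y : ℝ => rexp (c * |y - θ|))]
  have h₀ : 0 ≤ ∫ y, rexp (c * |y - θ|) ∂(gaussianReal θ v) :=
    integral_nonneg fun y => (Real.exp_pos _).le
  calc _ ≤ (2 * rexp (v * c ^ 2 / 2)) * (2 * rexp (v * c ^ 2 / 2)) := by gcongr
    _ = 4 * (rexp (v * c ^ 2 / 2) * rexp (v * c ^ 2 / 2)) := by ring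
    _ = _ := by rw [← Real.exp_add]; ring_nf

theorem norm_complexPair_sub_le (θ : ℝ) (y : ℝ × ℝ) :
    ‖complexPair y - θ‖ ≤ |y.1 - θ| + |y.2 - θ| := by
  have h : complexPair y - θ = (((y.1 - θ) + (y.2 - θ)) / 2 : ℝ)
      + (((y.1 - θ) - (y.2 - θ)) / 2 : ℝ) * Complex.I := by
    rw [complexPair]
    push_cast
    ring
  rw [h]
  refine (norm_add_le _ _).trans ?_
  rw [norm_mul, Complex.norm_I, mul_one, Complex.norm_real, Complex.norm_real, Real.norm_eq_abs,
    Real.norm_eq_abs, abs_div, abs_div, abs_two]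
  have h₁ := abs_add_le (y.1 - θ) (y.2 - θ)
  have h₂ := abs_sub (y.1 - θ) (y.2 - θ)
  linarith

theorem measurable_sinPowTrunc_complexPair (k : ℕ) (γ T : ℝ) :
    Measurable fun y => sinPowTrunc k γ T (complexPair y) := by
  have hm := continuous_complexPair.measurable
  have h : Measurable fun p : (ℝ × ℝ) × ℝ =>
      (Complex.sin (p.2 * complexPair p.1) ^ (k + 1)).re * p.2 ^ (-(1 + γ)) := by
    fun_prop
  exact (h.stronglyMeasurable.integral_prod_right' (ν := volume.restrict (Set.Ioc 0 T))).measurable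

theorem integral_sinPowTrunc_complexPair {k : ℕ} {γ T : ℝ} (hT : 0 < T) (hk : γ ≤ k) (θ : ℝ)
    (v : NNReal) :
    ∫ y, sinPowTrunc k γ T (complexPair y) ∂((gaussianReal θ v).prod (gaussianReal θ v))
      = sinPowTrunc k γ T θ := by
  set μ := (gaussianReal θ v).prod (gaussianReal θ v) with hμ
  have hm := continuous_complexPair.measurable
  set c : ℝ := (k + 1) * (1 + T) with hc
  have hcpos : 0 ≤ c := by positivity
  have hexp := (integral_exp_mul_abs_sub_prod_le θ v c).1.const_mul
    (T ^ (k - γ) * rexp (c * |θ|))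
  have hint : Integrable (Function.uncurry fun (y : ℝ × ℝ) (t : ℝ) =>
      (Complex.sin (t * complexPair y) ^ (k + 1)).re * t ^ (-(1 + γ)))
      (μ.prod (volume.restrict (Set.Ioc 0 T))) := by
    refine (hexp.mul_prod (integrable_const (1 : ℝ))).mono' ?_ ?_
    · unfold Function.uncurry
      fun_prop
    · have hae : ∀ᵐ p ∂(μ.prod (volume.restrict (Set.Ioc 0 T))), p.2 ∈ Set.Ioc 0 T :=
        Measure.quasiMeasurePreserving_snd.ae (ae_restrict_mem measurableSet_Ioc)
      filter_upwards [hae] with p hp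
      refine (norm_re_sin_pow_mul_rpow_le hk hp _).trans ?_
      have h₁ := norm_complexPair_sub_le θ p.1
      have h₂ := norm_le_norm_add_norm_sub' (complexPair p.1) θ
      rw [Complex.norm_real, Real.norm_eq_abs] at h₂
      rw [mul_one, mul_assoc, ← Real.exp_add]
      have h₃ : ‖complexPair p.1‖ ≤ rexp ‖complexPair p.1‖ := by
        linarith [Real.add_one_le_exp ‖complexPair p.1‖]
      calc _ ≤ T ^ (k - γ) * (rexp ‖complexPair p.1‖ * rexp (T * ‖complexPair p.1‖)) ^ (k + 1) := by
            gcongr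
        _ = T ^ (k - γ) * rexp (c * ‖complexPair p.1‖) := by
            rw [← Real.exp_add, ← Real.exp_nat_mul, hc]
            push_cast
            ring_nf
        _ ≤ _ := by
            rw [← mul_add]
            gcongr
            linarith
  unfold sinPowTrunc
  rw [integral_integral_swap hint]
  simp only [integral_mul_const, hμ, integral_re_sin_pow_complexPair]

theorem sq_sinPowTrunc_complexPair_sub_le {k : ℕ} {γ ε τ : ℝ} (hγ : 1 < γ) (hk : γ ≤ k)
    (hε : 0 < ε) (hτ : 0 < τ) (θ : ℝ) (y : ℝ × ℝ) :
    (sinPowTrunc k γ (τ / ε) (complexPair y) - sinPowTrunc k γ (τ / ε) θ) ^ 2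
      ≤ ((k + 1) * minPowConst k γ * ε * (|θ| + ε) ^ (γ - 1)) ^ 2
        * rexp (2 * (2 * (k + 1) * τ + γ) / ε * (|y.1 - θ| + |y.2 - θ|)) := by
  obtain ⟨r, hr⟩ : ∃ r, r = (|y.1 - θ| + |y.2 - θ|) / ε := ⟨_, rfl⟩
  have hr₀ : 0 ≤ r := by rw [hr]; positivity
  have hεr : |y.1 - θ| + |y.2 - θ| = ε * r := by rw [hr]; field_simp
  have hw := norm_complexPair_sub_le θ y
  rw [hεr] at hw ⊢
  have h := abs_sinPowTrunc_add_sub_le (T := τ / ε) hγ hk θ (complexPair y - θ)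
  rw [add_sub_cancel] at h
  set w := complexPair y - θ
  have hJ := minPowConst_nonneg k γ
  have hre : r ≤ rexp r := by linarith [Real.add_one_le_exp r]
  have h₁ : |θ| + ‖w‖ ≤ (|θ| + ε) * rexp r := by
    have := abs_nonneg θ
    nlinarith [Real.add_one_le_exp r]
  have h₂ : (|θ| + ‖w‖) ^ (γ - 1) ≤ (|θ| + ε) ^ (γ - 1) * rexp ((γ - 1) * r) := by
    rw [mul_comm (γ - 1) r, Real.exp_mul, ← Real.mul_rpow (by positivity) (Real.exp_pos _).le]
    exact Real.rpow_le_rpow (by positivity) h₁ (by linarith)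
  have h₃ : ‖w‖ ≤ ε * rexp r := hw.trans (by gcongr)
  have h₄ : rexp (2 * (k + 1) * (τ / ε) * ‖w‖) ≤ rexp (2 * (k + 1) * τ * r) := by
    rw [Real.exp_le_exp]
    calc _ ≤ 2 * (k + 1) * (τ / ε) * (ε * r) := by gcongr
      _ = _ := by field_simp
  have h₅ : |sinPowTrunc k γ (τ / ε) (complexPair y) - sinPowTrunc k γ (τ / ε) θ|
      ≤ (k + 1) * minPowConst k γ * ε * (|θ| + ε) ^ (γ - 1) * rexp ((2 * (k + 1) * τ + γ) * r) := by
    refine h.trans ?_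
    calc _ ≤ (k + 1) * minPowConst k γ * (ε * rexp r) * rexp (2 * (k + 1) * τ * r)
          * ((|θ| + ε) ^ (γ - 1) * rexp ((γ - 1) * r)) := by gcongr
      _ = (k + 1) * minPowConst k γ * ε * (|θ| + ε) ^ (γ - 1)
          * (rexp r * rexp (2 * (k + 1) * τ * r) * rexp ((γ - 1) * r)) := by ring
      _ = _ := by
          rw [← Real.exp_add, ← Real.exp_add]
          ring_nf
  rw [← sq_abs]
  refine (pow_le_pow_left₀ (abs_nonneg _) h₅ 2).trans_eq ?_
  rw [mul_pow, ← Real.exp_nat_mul]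
  congr 2
  push_cast
  field_simp

theorem memLp_variance_sinPowTrunc_complexPair {k : ℕ} {γ ε τ : ℝ} (hγ : 1 < γ) (hk : γ ≤ k)
    (hε : 0 < ε) (hτ : 0 < τ) (θ : ℝ) :
    MemLp (fun y => sinPowTrunc k γ (τ / ε) (complexPair y)) 2
        ((gaussianReal θ (2 * ε ^ 2).toNNReal).prod (gaussianReal θ (2 * ε ^ 2).toNNReal)) ∧
      Var[fun y => sinPowTrunc k γ (τ / ε) (complexPair y);
        (gaussianReal θ (2 * ε ^ 2).toNNReal).prod (gaussianReal θ (2 * ε ^ 2).toNNReal)]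
        ≤ ((k + 1) * minPowConst k γ * ε * (|θ| + ε) ^ (γ - 1)) ^ 2
          * (4 * rexp (8 * (2 * (k + 1) * τ + γ) ^ 2)) := by
  set μ := (gaussianReal θ (2 * ε ^ 2).toNNReal).prod (gaussianReal θ (2 * ε ^ 2).toNNReal)
  set B := ((k + 1) * minPowConst k γ * ε * (|θ| + ε) ^ (γ - 1)) ^ 2
  have hm := measurable_sinPowTrunc_complexPair k γ (τ / ε)
  obtain ⟨hei, hev⟩ := integral_exp_mul_abs_sub_prod_le θ (2 * ε ^ 2).toNNReal
    (2 * (2 * (k + 1) * τ + γ) / ε)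
  have hbd := sq_sinPowTrunc_complexPair_sub_le hγ hk hε hτ θ
  have hsq : Integrable (fun y => (sinPowTrunc k γ (τ / ε) (complexPair y)
      - sinPowTrunc k γ (τ / ε) θ) ^ 2) μ := by
    refine (hei.const_mul B).mono' ((hm.sub_const _).pow_const 2).aestronglyMeasurable
      (Filter.Eventually.of_forall fun y => ?_)
    rw [Real.norm_of_nonneg (sq_nonneg _)]
    exact hbd y
  have hmem : MemLp (fun y => sinPowTrunc k γ (τ / ε) (complexPair y)) 2 μ := by
    have h₁ := (memLp_two_iff_integrable_sq (hm.sub_const _).aestronglyMeasurable).2 hsq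
    exact (h₁.add (memLp_const (sinPowTrunc k γ (τ / ε) θ))).ae_eq
      (Filter.Eventually.of_forall fun y => by simp)
  refine ⟨hmem, ?_⟩
  rw [variance_eq_integral hm.aemeasurable,
    integral_sinPowTrunc_complexPair (by positivity) hk]
  refine (integral_mono hsq (hei.const_mul B) hbd).trans ?_
  rw [integral_const_mul]
  refine mul_le_mul_of_nonneg_left (hev.trans_eq ?_) (sq_nonneg _)
  rw [Real.coe_toNNReal _ (by positivity)]
  congr 2
  field_simp
  ring

theorem exists_coordinate_estimator {γ : ℝ} (hγ : 1 < γ) :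
    ∃ C A : ℝ, 0 < C ∧ 0 < A ∧ ∀ ε τ : ℝ, 0 < ε → 0 < τ →
      ∃ G : ℝ × ℝ → ℝ, Measurable G ∧ ∀ (θ : ℝ) (μ : Measure (ℝ × ℝ)),
        μ = (gaussianReal θ (2 * ε ^ 2).toNNReal).prod (gaussianReal θ (2 * ε ^ 2).toNNReal) →
        MemLp G 2 μ ∧ |∫ y, G y ∂μ - |θ| ^ γ| ≤ C * (ε / τ) ^ γ ∧ (θ = 0 → ∫ y, G y ∂μ = 0) ∧
        Var[G; μ] ≤ C * (ε ^ 2 * (|θ| ^ (2 * γ - 2) + ε ^ (2 * γ - 2)) * rexp (A * τ ^ 2)) := by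
  obtain ⟨n, hn⟩ := exists_nat_ge γ
  obtain ⟨k, hk, hev⟩ : ∃ k : ℕ, γ ≤ k ∧ Even (k + 1) :=
    ⟨2 * n + 1, by push_cast; linarith [Nat.cast_nonneg (α := ℝ) n], n + 1, by ring⟩
  have hI := sinPowConst_pos (by linarith) hk hev
  have hJ := minPowConst_nonneg k γ
  set I := sinPowConst k γ
  set J := minPowConst k γ
  set C₁ := I⁻¹ / γ
  set C₂ := I⁻¹ ^ 2 * (((k + 1) * J) ^ 2 * 2 ^ (2 * γ - 2)) * (4 * rexp (16 * γ ^ 2))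
  have hC₁ : 0 < C₁ := by positivity
  have hC₂ : 0 ≤ C₂ := by positivity
  refine ⟨C₁ + C₂, 64 * (k + 1) ^ 2, by positivity, by positivity, fun ε τ hε hτ => ?_⟩
  refine ⟨fun y => I⁻¹ * sinPowTrunc k γ (τ / ε) (complexPair y),
    (measurable_sinPowTrunc_complexPair k γ _).const_mul _, ?_⟩
  rintro θ μ rfl
  obtain ⟨hmem, hvar⟩ := memLp_variance_sinPowTrunc_complexPair hγ hk hε hτ θ
  have hT : 0 < τ / ε := by positivity
  refine ⟨hmem.const_mul _, ?_, ?_, ?_⟩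
  · rw [integral_const_mul, integral_sinPowTrunc_complexPair hT hk]
    have h := abs_sinPowTrunc_sub_le (by linarith) hk hev hT θ
    have e : I⁻¹ * sinPowTrunc k γ (τ / ε) θ - |θ| ^ γ
        = I⁻¹ * (sinPowTrunc k γ (τ / ε) θ - I * |θ| ^ γ) := by
      field_simp
    rw [e, abs_mul, abs_of_pos (inv_pos.2 hI)]
    have e₂ : (τ / ε) ^ (-γ) = (ε / τ) ^ γ := by
      rw [Real.rpow_neg hT.le, ← Real.inv_rpow hT.le, inv_div]
    calc _ ≤ I⁻¹ * ((τ / ε) ^ (-γ) / γ) := by gcongr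
      _ = C₁ * (ε / τ) ^ γ := by rw [e₂]; ring
      _ ≤ _ := by gcongr; linarith
  · rintro rfl
    rw [integral_const_mul, integral_sinPowTrunc_complexPair hT hk]
    simp [sinPowTrunc_zero]
  · rw [variance_const_mul]
    have hpow : ((|θ| + ε) ^ (γ - 1)) ^ 2
        ≤ 2 ^ (2 * γ - 2) * (|θ| ^ (2 * γ - 2) + ε ^ (2 * γ - 2)) := by
      have hp : 0 ≤ 2 * γ - 2 := by linarith
      have h₀ : ((|θ| + ε) ^ (γ - 1)) ^ 2 = (|θ| + ε) ^ (2 * γ - 2) := by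
        rw [← Real.rpow_mul_natCast (by positivity)]
        congr 1
        push_cast
        ring
      have ha := Real.rpow_nonneg (abs_nonneg θ) (2 * γ - 2)
      have hb := Real.rpow_nonneg hε.le (2 * γ - 2)
      have hmax : |θ| + ε ≤ 2 * max |θ| ε := by
        linarith [le_max_left |θ| ε, le_max_right |θ| ε]
      rw [h₀]
      refine (Real.rpow_le_rpow (by positivity) hmax hp).trans ?_
      rw [Real.mul_rpow zero_le_two (by positivity)]
      gcongr
      rcases max_choice |θ| ε with h | h <;> rw [h] <;> linarith
    have hexp : rexp (8 * (2 * (k + 1) * τ + γ) ^ 2)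
        ≤ rexp (16 * γ ^ 2) * rexp (64 * (k + 1) ^ 2 * τ ^ 2) := by
      rw [← Real.exp_add, Real.exp_le_exp]
      nlinarith [sq_nonneg (2 * (k + 1) * τ - γ)]
    refine (mul_le_mul_of_nonneg_left hvar (sq_nonneg _)).trans ?_
    calc _ = I⁻¹ ^ 2 * (((k + 1) * J) ^ 2 * ε ^ 2 * ((|θ| + ε) ^ (γ - 1)) ^ 2
          * (4 * rexp (8 * (2 * (k + 1) * τ + γ) ^ 2))) := by ring
      _ ≤ I⁻¹ ^ 2 * (((k + 1) * J) ^ 2 * ε ^ 2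
          * (2 ^ (2 * γ - 2) * (|θ| ^ (2 * γ - 2) + ε ^ (2 * γ - 2)))
          * (4 * (rexp (16 * γ ^ 2) * rexp (64 * (k + 1) ^ 2 * τ ^ 2)))) := by gcongr
      _ = C₂ * (ε ^ 2 * (|θ| ^ (2 * γ - 2) + ε ^ (2 * γ - 2))
          * rexp (64 * (k + 1) ^ 2 * τ ^ 2)) := by ring
      _ ≤ _ := by gcongr; linarith

theorem integral_sq_sum_pi_sub {ι : Type*} [Fintype ι] {Ω : ι → Type*}
    [∀ i, MeasurableSpace (Ω i)] {μ : (i : ι) → Measure (Ω i)} [∀ i, IsProbabilityMeasure (μ i)]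
    {X : (i : ι) → Ω i → ℝ} (hX : ∀ i, MemLp (X i) 2 (μ i)) (b : ℝ) :
    Integrable (fun ω => (∑ i, X i (ω i) - b) ^ 2) (Measure.pi μ) ∧
      ∫ ω, (∑ i, X i (ω i) - b) ^ 2 ∂(Measure.pi μ)
        = ∑ i, Var[X i; μ i] + (∑ i, ∫ x, X i x ∂(μ i) - b) ^ 2 := by
  have hmem (i : ι) : MemLp (fun ω : (i : ι) → Ω i => X i (ω i)) 2 (Measure.pi μ) :=
    (hX i).comp_measurePreserving (measurePreserving_eval μ i)
  have hint (i : ι) : ∫ ω, X i (ω i) ∂(Measure.pi μ) = ∫ x, X i x ∂(μ i) :=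
    integral_comp_eval (hX i).aestronglyMeasurable
  have hsum : MemLp (fun ω : (i : ι) → Ω i => ∑ i, X i (ω i)) 2 (Measure.pi μ) :=
    memLp_finsetSum _ fun i _ => hmem i
  have hsub : MemLp (fun ω : (i : ι) → Ω i => ∑ i, X i (ω i) - b) 2 (Measure.pi μ) :=
    hsum.sub (memLp_const b)
  have hvar := variance_sum_pi hX
  have hfun : (∑ i, fun ω : (i : ι) → Ω i => X i (ω i)) = fun ω => ∑ i, X i (ω i) := by
    ext ω
    simp
  rw [hfun, ← variance_sub_const hsum.aestronglyMeasurable b, variance_eq_sub hsub] at hvar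
  have hmean : ∫ ω, (∑ i, X i (ω i) - b) ∂(Measure.pi μ) = ∑ i, ∫ x, X i x ∂(μ i) - b := by
    rw [integral_sub (hsum.integrable one_le_two) (integrable_const b),
      integral_finsetSum _ fun i _ => (hmem i).integrable one_le_two]
    simp [hint]
  refine ⟨hsub.integrable_sq, ?_⟩
  rw [hmean] at hvar
  rw [← hvar, sub_add_cancel]
  rfl

theorem abs_sub_le_add_abs_rpow_sub_div {γ a q u : ℝ} (hγ : 1 < γ) (ha : 0 < a) (hq : 0 ≤ q)
    (hu : 0 ≤ u) : |u - q| ≤ a + |u ^ γ - q ^ γ| / max a q ^ (γ - 1) := by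
  have hM : 0 < max a q := lt_max_of_lt_left ha
  have hMp : 0 < max a q ^ (γ - 1) := Real.rpow_pos_of_pos hM _
  have hsplit (x : ℝ) (hx : 0 ≤ x) : x ^ γ = x * x ^ (γ - 1) := by
    rw [← Real.rpow_one_add' hx (by linarith)]
    ring_nf
  suffices h : a < |u - q| → |u - q| * max a q ^ (γ - 1) ≤ |u ^ γ - q ^ γ| by
    have h₀ : 0 ≤ |u ^ γ - q ^ γ| / max a q ^ (γ - 1) := by positivity
    rcases le_or_gt |u - q| a with h₁ | h₁
    · linarith
    · linarith [(le_div_iff₀ hMp).2 (h h₁)]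
  intro hlt
  rcases le_total q a with hqa | hqa
  · rw [max_eq_left hqa]
    have h₁ : |u - q| * a ^ (γ - 1) ≤ |u - q| ^ γ := by
      rw [hsplit _ (abs_nonneg _)]
      gcongr
    refine h₁.trans ?_
    rcases le_total q u with h | h
    · have h₂ := Real.add_rpow_le_rpow_add (sub_nonneg.2 h) hq hγ.le
      rw [sub_add_cancel] at h₂
      rw [abs_of_nonneg (sub_nonneg.2 h)]
      exact le_trans (by linarith) (le_abs_self _)
    · have h₂ := Real.add_rpow_le_rpow_add (sub_nonneg.2 h) hu hγ.le
      rw [sub_add_cancel] at h₂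
      rw [abs_sub_comm, abs_of_nonneg (sub_nonneg.2 h), abs_sub_comm]
      exact le_trans (by linarith) (le_abs_self _)
  · rw [max_eq_right hqa, hsplit u hu, hsplit q hq]
    rcases le_total q u with h | h
    · have h₂ : q ^ (γ - 1) ≤ u ^ (γ - 1) := Real.rpow_le_rpow hq h (by linarith)
      rw [abs_of_nonneg (sub_nonneg.2 h)]
      refine le_trans ?_ (le_abs_self _)
      nlinarith
    · have h₂ : u ^ (γ - 1) ≤ q ^ (γ - 1) := Real.rpow_le_rpow hu h (by linarith)
      rw [abs_sub_comm, abs_of_nonneg (sub_nonneg.2 h), abs_sub_comm]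
      refine le_trans ?_ (le_abs_self _)
      nlinarith

theorem sum_abs_rpow_le {γ : ℝ} (hγ : 1 < γ) {d s : ℕ} (hs : 1 ≤ s) {θ : Fin d → ℝ}
    (hθ : (Finset.univ.filter fun i => θ i ≠ 0).card ≤ s) :
    ∑ i, |θ i| ^ (2 * γ - 2)
      ≤ 2 * (s : ℝ) ^ (2 / γ - min 1 (2 / γ)) * ((∑ i, |θ i| ^ γ) ^ (1 / γ)) ^ (2 * γ - 2) := by
  set Q := ∑ i, |θ i| ^ γ with hQ
  have hγ₀ : 0 < γ := by linarith
  have hp : 0 < 2 * γ - 2 := by linarith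
  have hs₀ : (0 : ℝ) < s := by exact_mod_cast hs
  have hterm (i : Fin d) : 0 ≤ |θ i| ^ γ := by positivity
  have hle (i : Fin d) : |θ i| ^ γ ≤ Q :=
    Finset.single_le_sum (f := fun i => |θ i| ^ γ) (fun j _ => hterm j) (Finset.mem_univ i)
  have hQ₀ : 0 ≤ Q := Finset.sum_nonneg fun i _ => hterm i
  rcases hQ₀.eq_or_lt with h0 | hQpos
  · have hz (i : Fin d) : θ i = 0 := by
      have h₁ : |θ i| ^ γ = 0 := le_antisymm (h0 ▸ hle i) (hterm i)
      simpa using (Real.rpow_eq_zero (abs_nonneg _) hγ₀.ne').1 h₁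
    simp only [hz, abs_zero, Real.zero_rpow hp.ne', Finset.sum_const_zero]
    positivity
  rcases le_total 2 γ with h2 | h2
  · have hmin : min 1 (2 / γ) = 2 / γ := min_eq_right ((div_le_one hγ₀).2 h2)
    rw [hmin, sub_self, Real.rpow_zero, mul_one]
    have hi (i : Fin d) : |θ i| ^ (2 * γ - 2) ≤ |θ i| ^ γ * (Q ^ (1 / γ)) ^ (γ - 2) := by
      have h₁ : |θ i| ≤ Q ^ (1 / γ) := by
        rw [one_div]
        exact (Real.le_rpow_inv_iff_of_pos (abs_nonneg _) hQ₀ hγ₀).2 (hle i)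
      rw [show 2 * γ - 2 = γ + (γ - 2) by ring,
        Real.rpow_add_of_nonneg (abs_nonneg _) hγ₀.le (by linarith)]
      gcongr
    refine (Finset.sum_le_sum fun i _ => hi i).trans ?_
    rw [← Finset.sum_mul, ← hQ]
    have e : Q * (Q ^ (1 / γ)) ^ (γ - 2) = (Q ^ (1 / γ)) ^ (2 * γ - 2) := by
      rw [← Real.rpow_mul hQ₀, ← Real.rpow_mul hQ₀, ← Real.rpow_one_add' hQ₀]
      · congr 1
        field_simp
        ring
      · have : 0 ≤ 1 / γ * (γ - 2) := by
          have : 0 ≤ γ - 2 := by linarith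
          positivity
        linarith
    rw [e]
    have : 0 ≤ (Q ^ (1 / γ)) ^ (2 * γ - 2) := by positivity
    linarith
  · have hmin : min 1 (2 / γ) = 1 := min_eq_left ((one_le_div hγ₀).2 h2)
    rw [hmin]
    set r := (2 * γ - 2) / γ with hr
    have hr₀ : 0 ≤ r := by positivity
    have hr₁ : r ≤ 1 := (div_le_one hγ₀).2 (by linarith)
    have e₁ : (Q ^ (1 / γ)) ^ (2 * γ - 2) = Q ^ r := by
      rw [← Real.rpow_mul hQ₀, hr]
      congr 1
      ring
    have hv (v : ℝ) (h : 0 ≤ v) : v ^ r ≤ 1 + v := by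
      rcases le_total v 1 with h₁ | h₁
      · linarith [Real.rpow_le_one h h₁ hr₀]
      · have := Real.rpow_le_rpow_of_exponent_le h₁ hr₁
        rw [Real.rpow_one] at this
        linarith
    have hi (i : Fin d) : |θ i| ^ (2 * γ - 2) ≤ Q ^ r * (s : ℝ) ^ (-r) * (1 + s * (|θ i| ^ γ / Q)) := by
      have h₁ := hv (s * (|θ i| ^ γ / Q)) (by positivity)
      have h₂ : (s * (|θ i| ^ γ / Q)) ^ r = (s : ℝ) ^ r * (|θ i| ^ (2 * γ - 2) / Q ^ r) := by
        rw [Real.mul_rpow hs₀.le (by positivity), Real.div_rpow (hterm i) hQ₀,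
          ← Real.rpow_mul (abs_nonneg _), hr, mul_div_cancel₀ _ hγ₀.ne']
      have h₃ : |θ i| ^ (2 * γ - 2)
          = Q ^ r * (s : ℝ) ^ (-r) * ((s : ℝ) ^ r * (|θ i| ^ (2 * γ - 2) / Q ^ r)) := by
        rw [Real.rpow_neg hs₀.le]
        field_simp
      rw [h₃, ← h₂]
      gcongr
    have hsupp : ∑ i, |θ i| ^ (2 * γ - 2)
        = ∑ i ∈ Finset.univ.filter (fun i => θ i ≠ 0), |θ i| ^ (2 * γ - 2) := by
      rw [Finset.sum_filter_of_ne]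
      intro i _ h hz
      rw [hz, abs_zero, Real.zero_rpow hp.ne'] at h
      exact h rfl
    have hpart : ∑ i ∈ Finset.univ.filter (fun i => θ i ≠ 0), |θ i| ^ γ ≤ Q :=
      Finset.sum_le_univ_sum_of_nonneg hterm
    have hcard : ((Finset.univ.filter fun i => θ i ≠ 0).card : ℝ) ≤ s := by exact_mod_cast hθ
    rw [hsupp, e₁]
    refine (Finset.sum_le_sum fun i _ => hi i).trans ?_
    rw [← Finset.mul_sum, Finset.sum_add_distrib, ← Finset.mul_sum, ← Finset.sum_div,
      Finset.sum_const, nsmul_eq_mul, mul_one]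
    have h₄ : (∑ i ∈ Finset.univ.filter (fun i => θ i ≠ 0), |θ i| ^ γ) / Q ≤ 1 :=
      (div_le_one hQpos).2 hpart
    have e₂ : (s : ℝ) ^ (2 / γ - 1) = (s : ℝ) ^ (-r) * s := by
      rw [← Real.rpow_add_one hs₀.ne']
      congr 1
      rw [hr]
      field_simp
      ring
    rw [e₂]
    calc _ ≤ Q ^ r * (s : ℝ) ^ (-r) * (s + s * 1) := by gcongr
      _ = _ := by ring

theorem exp_mul_sq_le {A γ δ L τ : ℝ} (hA : 0 < A) (hγ : 1 < γ) (hδ : 0 < δ) (hδ₁ : δ ≤ 1)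
    (hL : 0 ≤ L) (hτ : 0 < τ) (hτL : τ ^ 2 = δ / (A + γ + 1) * L) :
    rexp (A * τ ^ 2) * (τ ^ γ) ^ 2 ≤ rexp L ∧ rexp (A * τ ^ 2) * τ ^ 2 ≤ rexp (δ * L) := by
  have hD : 0 < A + γ + 1 := by linarith
  have hx : (A + γ + 1) * τ ^ 2 = δ * L := by
    rw [hτL]
    field_simp
  have hx₀ : 0 ≤ τ ^ 2 := sq_nonneg τ
  have hexp : τ ^ 2 ≤ rexp (τ ^ 2) := by linarith [Real.add_one_le_exp (τ ^ 2)]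
  have hpow : (τ ^ γ) ^ 2 ≤ rexp (γ * τ ^ 2) := by
    rw [← Real.rpow_mul_natCast hτ.le, mul_comm γ, Nat.cast_ofNat, Real.rpow_mul hτ.le,
      Real.rpow_ofNat, mul_comm γ, Real.exp_mul]
    exact Real.rpow_le_rpow hx₀ hexp (by linarith)
  constructor
  · calc _ ≤ rexp (A * τ ^ 2) * rexp (γ * τ ^ 2) := by gcongr
      _ ≤ rexp L := by
        rw [← Real.exp_add, Real.exp_le_exp]
        nlinarith
  · calc _ ≤ rexp (A * τ ^ 2) * rexp (τ ^ 2) := by gcongr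
      _ ≤ rexp (δ * L) := by
        rw [← Real.exp_add, Real.exp_le_exp]
        nlinarith

theorem integral_sq_sum_sub_le {γ C A ε τ : ℝ} (hγ : 1 < γ) (hC : 0 < C) (hε : 0 < ε)
    (hτ : 0 < τ) {d s : ℕ} (hs : 1 ≤ s)
    (hd : rexp (A * τ ^ 2) * (τ ^ γ) ^ 2 * d ≤ (s : ℝ) ^ 2)
    (hsδ : rexp (A * τ ^ 2) * τ ^ 2 ≤ (s : ℝ) ^ min 1 (2 / γ))
    {θ : Fin d → ℝ} (hθ : (Finset.univ.filter fun i => θ i ≠ 0).card ≤ s)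
    {μ : Fin d → Measure (ℝ × ℝ)} [∀ i, IsProbabilityMeasure (μ i)] {G : ℝ × ℝ → ℝ}
    (hG : ∀ i, MemLp G 2 (μ i))
    (hbias : ∀ i, |∫ y, G y ∂(μ i) - |θ i| ^ γ| ≤ C * (ε / τ) ^ γ)
    (hzero : ∀ i, θ i = 0 → ∫ y, G y ∂(μ i) = 0)
    (hvar : ∀ i, Var[G; μ i]
      ≤ C * (ε ^ 2 * (|θ i| ^ (2 * γ - 2) + ε ^ (2 * γ - 2)) * rexp (A * τ ^ 2))) :
    ∫ y, (∑ i, G (y i) - ∑ i, |θ i| ^ γ) ^ 2 ∂(Measure.pi μ)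
      ≤ (3 * C + C ^ 2) * ((s : ℝ) ^ (1 / γ) * (ε / τ)) ^ 2
        * (max ((s : ℝ) ^ (1 / γ) * (ε / τ)) ((∑ i, |θ i| ^ γ) ^ (1 / γ)) ^ (γ - 1)) ^ 2 := by
  have hγ₀ : 0 < γ := by linarith
  have hs₀ : (0 : ℝ) < s := by exact_mod_cast hs
  rw [(integral_sq_sum_pi_sub hG _).2]
  set a := (s : ℝ) ^ (1 / γ) * (ε / τ) with ha
  set q := (∑ i, |θ i| ^ γ) ^ (1 / γ) with hq
  have ha₀ : 0 < a := by positivity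
  have hq₀ : 0 ≤ q := by positivity
  have hM : 0 < max a q := lt_max_of_lt_left ha₀
  have hsq (x : ℝ) (hx : 0 ≤ x) : (x ^ (γ - 1)) ^ 2 = x ^ (2 * γ - 2) := by
    rw [← Real.rpow_mul_natCast hx]
    congr 1
    push_cast
    ring
  have haγ : a ^ γ = s * (ε / τ) ^ γ := by
    rw [ha, Real.mul_rpow (by positivity) (by positivity), ← Real.rpow_mul hs₀.le,
      one_div_mul_cancel hγ₀.ne', Real.rpow_one]
  have ha2 (x : ℝ) (hx : 0 < x) : x ^ 2 * x ^ (2 * γ - 2) = (x ^ γ) ^ 2 := by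
    rw [← Real.rpow_natCast x 2, ← Real.rpow_add hx, ← Real.rpow_mul_natCast hx.le]
    congr 1
    push_cast
    ring
  have hb : |∑ i, ∫ y, G y ∂(μ i) - ∑ i, |θ i| ^ γ| ≤ C * a ^ γ := by
    rw [← Finset.sum_sub_distrib]
    have hsupp : ∑ i, (∫ y, G y ∂(μ i) - |θ i| ^ γ)
        = ∑ i ∈ Finset.univ.filter (fun i => θ i ≠ 0), (∫ y, G y ∂(μ i) - |θ i| ^ γ) := by
      rw [Finset.sum_filter_of_ne]
      intro i _ h hz
      rw [hzero i hz, hz, abs_zero, Real.zero_rpow hγ₀.ne', sub_zero] at h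
      exact h rfl
    rw [hsupp]
    have hcard : ((Finset.univ.filter fun i => θ i ≠ 0).card : ℝ) ≤ s := by exact_mod_cast hθ
    refine (Finset.abs_sum_le_sum_abs _ _).trans ((Finset.sum_le_sum fun i _ => hbias i).trans ?_)
    rw [Finset.sum_const, nsmul_eq_mul, haγ]
    calc _ ≤ s * (C * (ε / τ) ^ γ) := by gcongr
      _ = _ := by ring
  have hb₂ : (∑ i, ∫ y, G y ∂(μ i) - ∑ i, |θ i| ^ γ) ^ 2 ≤ C ^ 2 * (a ^ γ) ^ 2 := by
    rw [← sq_abs, ← mul_pow]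
    exact pow_le_pow_left₀ (abs_nonneg _) hb 2
  have hnoise : rexp (A * τ ^ 2) * d * (ε ^ 2 * ε ^ (2 * γ - 2)) ≤ (a ^ γ) ^ 2 := by
    have hτγ : 0 < τ ^ γ := Real.rpow_pos_of_pos hτ _
    rw [ha2 ε hε, haγ, Real.div_rpow hε.le hτ.le]
    calc _ = rexp (A * τ ^ 2) * (τ ^ γ) ^ 2 * d * (ε ^ γ / τ ^ γ) ^ 2 := by field_simp
      _ ≤ (s : ℝ) ^ 2 * (ε ^ γ / τ ^ γ) ^ 2 := by gcongr
      _ = _ := by ring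
  have hsignal : rexp (A * τ ^ 2) * ε ^ 2 * ∑ i, |θ i| ^ (2 * γ - 2)
      ≤ 2 * a ^ 2 * q ^ (2 * γ - 2) := by
    have hqp : 0 ≤ q ^ (2 * γ - 2) := Real.rpow_nonneg hq₀ _
    have e₁ : ((s : ℝ) ^ (1 / γ)) ^ 2
        = (s : ℝ) ^ min 1 (2 / γ) * (s : ℝ) ^ (2 / γ - min 1 (2 / γ)) := by
      rw [← Real.rpow_add hs₀, ← Real.rpow_mul_natCast hs₀.le]
      congr 1
      push_cast
      ring
    calc _ ≤ rexp (A * τ ^ 2) * ε ^ 2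
          * (2 * (s : ℝ) ^ (2 / γ - min 1 (2 / γ)) * q ^ (2 * γ - 2)) := by
          gcongr
          exact sum_abs_rpow_le hγ hs hθ
      _ = rexp (A * τ ^ 2) * τ ^ 2 * (2 * (s : ℝ) ^ (2 / γ - min 1 (2 / γ)) * (ε / τ) ^ 2
          * q ^ (2 * γ - 2)) := by field_simp
      _ ≤ (s : ℝ) ^ min 1 (2 / γ) * (2 * (s : ℝ) ^ (2 / γ - min 1 (2 / γ)) * (ε / τ) ^ 2
          * q ^ (2 * γ - 2)) := by gcongr
      _ = _ := by rw [ha, mul_pow, e₁]; ring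
  have hvsum : ∑ i, Var[G; μ i] ≤ C * (2 * a ^ 2 * q ^ (2 * γ - 2) + (a ^ γ) ^ 2) := by
    refine (Finset.sum_le_sum fun i _ => hvar i).trans ?_
    rw [← Finset.mul_sum, ← Finset.sum_mul, ← Finset.mul_sum, Finset.sum_add_distrib,
      Finset.sum_const, Finset.card_univ, Fintype.card_fin, nsmul_eq_mul]
    gcongr
    linarith
  rw [hsq _ hM.le]
  have hqM : q ^ (2 * γ - 2) ≤ max a q ^ (2 * γ - 2) :=
    Real.rpow_le_rpow hq₀ (le_max_right _ _) (by linarith)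
  have haM : (a ^ γ) ^ 2 ≤ a ^ 2 * max a q ^ (2 * γ - 2) := by
    rw [← ha2 a ha₀]
    gcongr
    · linarith
    · exact le_max_left _ _
  calc _ ≤ C * (2 * a ^ 2 * q ^ (2 * γ - 2) + (a ^ γ) ^ 2) + C ^ 2 * (a ^ γ) ^ 2 :=
        add_le_add hvsum hb₂
    _ ≤ C * (2 * a ^ 2 * max a q ^ (2 * γ - 2) + a ^ 2 * max a q ^ (2 * γ - 2))
        + C ^ 2 * (a ^ 2 * max a q ^ (2 * γ - 2)) := by gcongr
    _ = _ := by ring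

theorem sq_rpow_max_sub_le {γ a Q S : ℝ} (hγ : 1 < γ) (ha : 0 < a) (hQ : 0 ≤ Q) :
    (max S 0 ^ (1 / γ) - Q ^ (1 / γ)) ^ 2
      ≤ 2 * a ^ 2 + 2 / (max a (Q ^ (1 / γ)) ^ (γ - 1)) ^ 2 * (S - Q) ^ 2 := by
  have hS : 0 ≤ max S 0 := le_max_right _ _
  have hM : 0 < max a (Q ^ (1 / γ)) := lt_max_of_lt_left ha
  have h := abs_sub_le_add_abs_rpow_sub_div hγ ha (Real.rpow_nonneg hQ (1 / γ))
    (Real.rpow_nonneg hS (1 / γ))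
  have hinv (x : ℝ) (hx : 0 ≤ x) : (x ^ (1 / γ)) ^ γ = x := by
    rw [← Real.rpow_mul hx, one_div_mul_cancel (by linarith), Real.rpow_one]
  rw [hinv _ hS, hinv _ hQ] at h
  have h₁ : |max S 0 - Q| ≤ |S - Q| := by
    simpa [max_eq_left hQ] using abs_max_sub_max_le_abs S Q 0
  set M := max a (Q ^ (1 / γ)) ^ (γ - 1)
  have hMp : 0 < M := Real.rpow_pos_of_pos hM _
  have h₂ := h.trans (add_le_add_right (div_le_div_of_nonneg_right h₁ hMp.le) a)
  rw [← sq_abs]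
  calc _ ≤ (a + |S - Q| / M) ^ 2 := pow_le_pow_left₀ (abs_nonneg _) h₂ 2
    _ ≤ 2 * (a ^ 2 + (|S - Q| / M) ^ 2) := add_sq_le
    _ = _ := by rw [div_pow, sq_abs]; ring

/-- The upper bound together with the integrability of the squared error. -/
theorem exists_norm_estimator {γ : ℝ} (hγ : 1 < γ) :
    ∃ C : ℝ, 0 < C ∧
      ∀ d s : ℕ, 1 ≤ s → s ≤ d → 4 * d ≤ s ^ 2 →
        ∀ ε : ℝ, 0 < ε →
          ∃ T : (Fin d → ℝ) × (Fin d → ℝ) → ℝ, Measurable T ∧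
            ∀ θ : Fin d → ℝ, (Finset.univ.filter fun i => θ i ≠ 0).card ≤ s →
              Integrable (fun y => (T y - (∑ i, |θ i| ^ γ) ^ (1 / γ)) ^ 2)
                ((Measure.pi fun i : Fin d => gaussianReal (θ i) (2 * ε ^ 2).toNNReal).prod
                  (Measure.pi fun i : Fin d => gaussianReal (θ i) (2 * ε ^ 2).toNNReal)) ∧
              ∫ y, (T y - (∑ i, |θ i| ^ γ) ^ (1 / γ)) ^ 2
                  ∂((Measure.pi fun i : Fin d => gaussianReal (θ i) (2 * ε ^ 2).toNNReal).prod
                    (Measure.pi fun i : Fin d => gaussianReal (θ i) (2 * ε ^ 2).toNNReal))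
                ≤ C * ε ^ 2 * (s : ℝ) ^ (2 / γ) / Real.log ((s : ℝ) ^ 2 / d) := by
  obtain ⟨C, A, hC, hA, hcoord⟩ := exists_coordinate_estimator hγ
  have hγ₀ : 0 < γ := by linarith
  set δ := min 1 (2 / γ) with hδdef
  have hδ : 0 < δ := lt_min one_pos (by positivity)
  have hδ₁ : δ ≤ 1 := min_le_left _ _
  set κ := δ / (A + γ + 1) with hκdef
  have hκ : 0 < κ := by positivity
  refine ⟨(2 + 2 * (3 * C + C ^ 2)) / κ, by positivity, fun d s hs hsd h4 ε hε => ?_⟩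
  have hs₀ : (0 : ℝ) < s := by exact_mod_cast hs
  have hsd' : (s : ℝ) ≤ d := by exact_mod_cast hsd
  have hd₀ : (0 : ℝ) < d := hs₀.trans_le hsd'
  have h4' : 4 * (d : ℝ) ≤ (s : ℝ) ^ 2 := by exact_mod_cast h4
  set L := Real.log ((s : ℝ) ^ 2 / d) with hLdef
  have hL : 0 < L := Real.log_pos ((one_lt_div hd₀).2 (by linarith))
  have hexpL : rexp L = (s : ℝ) ^ 2 / d := Real.exp_log (by positivity)
  have hexpL_le : rexp L ≤ s := by
    rw [hexpL, div_le_iff₀ hd₀, sq]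
    gcongr
  set τ := √(κ * L) with hτdef
  have hτ : 0 < τ := Real.sqrt_pos.2 (by positivity)
  have hτ2 : τ ^ 2 = κ * L := Real.sq_sqrt (by positivity)
  obtain ⟨hb₁, hb₂⟩ := exp_mul_sq_le hA hγ hδ hδ₁ hL.le hτ hτ2
  have hd : rexp (A * τ ^ 2) * (τ ^ γ) ^ 2 * d ≤ (s : ℝ) ^ 2 := by
    rw [hexpL] at hb₁
    exact (le_div_iff₀ hd₀).1 hb₁
  have hsδ : rexp (A * τ ^ 2) * τ ^ 2 ≤ (s : ℝ) ^ δ := by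
    refine hb₂.trans ?_
    rw [mul_comm, Real.exp_mul]
    exact Real.rpow_le_rpow (Real.exp_pos _).le hexpL_le hδ.le
  obtain ⟨G, hGm, hG⟩ := hcoord ε τ hε hτ
  refine ⟨fun y => max (∑ i, G (y.1 i, y.2 i)) 0 ^ (1 / γ), ?_, fun θ hθ => ?_⟩
  · have hsum : Measurable fun y : (Fin d → ℝ) × (Fin d → ℝ) => ∑ i, G (y.1 i, y.2 i) :=
      Finset.measurable_fun_sum _ fun i _ => hGm.comp (by fun_prop)
    exact (hsum.max measurable_const).pow_const _
  set g := fun i : Fin d => gaussianReal (θ i) (2 * ε ^ 2).toNNReal with hg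
  set μ := fun i : Fin d => (g i).prod (g i) with hμ
  have hGi (i : Fin d) := hG (θ i) (μ i) rfl
  have hbound := integral_sq_sum_sub_le (A := A) hγ hC hε hτ hs hd hsδ hθ (fun i => (hGi i).1)
    (fun i => (hGi i).2.1) (fun i => (hGi i).2.2.1) (fun i => (hGi i).2.2.2)
  set Q := ∑ i, |θ i| ^ γ
  have hQ : 0 ≤ Q := by positivity
  set a := (s : ℝ) ^ (1 / γ) * (ε / τ) with ha
  have ha₀ : 0 < a := by positivity
  set M := max a (Q ^ (1 / γ)) ^ (γ - 1)
  have hM : 0 < M := Real.rpow_pos_of_pos (lt_max_of_lt_left ha₀) _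
  have hMP := measurePreserving_arrowProdEquivProdArrow ℝ ℝ (Fin d) g g
  have hSint := (integral_sq_sum_pi_sub (fun i => (hGi i).1) Q).1
  have hmaj : Integrable (fun x : Fin d → ℝ × ℝ =>
      2 * a ^ 2 + 2 / M ^ 2 * (∑ i, G (x i) - Q) ^ 2) (Measure.pi μ) :=
    (integrable_const _).add (hSint.const_mul _)
  have hle (x : Fin d → ℝ × ℝ) :
      (max (∑ i, G (x i)) 0 ^ (1 / γ) - Q ^ (1 / γ)) ^ 2
        ≤ 2 * a ^ 2 + 2 / M ^ 2 * (∑ i, G (x i) - Q) ^ 2 := sq_rpow_max_sub_le hγ ha₀ hQ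
  have hSm : Measurable fun x : Fin d → ℝ × ℝ => ∑ i, G (x i) :=
    Finset.measurable_fun_sum _ fun i _ => hGm.comp (by fun_prop)
  have herr : Integrable (fun x : Fin d → ℝ × ℝ =>
      (max (∑ i, G (x i)) 0 ^ (1 / γ) - Q ^ (1 / γ)) ^ 2) (Measure.pi μ) := by
    refine hmaj.mono' (((((hSm.max measurable_const).pow_const _).sub_const _).pow_const
      2).aestronglyMeasurable) (Filter.Eventually.of_forall fun x => ?_)
    rw [Real.norm_of_nonneg (sq_nonneg _)]
    exact hle x
  refine ⟨(hMP.integrable_comp_emb (MeasurableEquiv.measurableEmbedding _)).1 herr, ?_⟩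
  rw [← hMP.integral_comp']
  have ha2 : a ^ 2 = (s : ℝ) ^ (2 / γ) * ε ^ 2 / (κ * L) := by
    rw [ha, mul_pow, div_pow, hτ2, ← Real.rpow_mul_natCast hs₀.le, mul_div_assoc]
    congr 2
    push_cast
    ring
  calc _ ≤ ∫ x, (2 * a ^ 2 + 2 / M ^ 2 * (∑ i, G (x i) - Q) ^ 2) ∂(Measure.pi μ) :=
        integral_mono herr hmaj hle
    _ = 2 * a ^ 2 + 2 / M ^ 2 * ∫ x, (∑ i, G (x i) - Q) ^ 2 ∂(Measure.pi μ) := by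
        rw [integral_add (integrable_const _) (hSint.const_mul _)]
        simp [integral_const_mul]
    _ ≤ 2 * a ^ 2 + 2 / M ^ 2 * ((3 * C + C ^ 2) * a ^ 2 * M ^ 2) := by gcongr
    _ = (2 + 2 * (3 * C + C ^ 2)) * a ^ 2 := by field_simp
    _ = _ := by rw [ha2]; field_simp

/-- Theorem 3(i) (dense zone upper bound for estimating the `ℓ_γ`-norm, `γ > 1`).
For every `γ > 1` there is a constant `C > 0` depending only on `γ` such that for all
integers `1 ≤ s ≤ d` with `s² ≥ 4d` and every `ε > 0`, there exists a Borel measurable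
estimator `T : ℝ^d × ℝ^d → ℝ` based on two independent samples `y_{j,i} ~ N(θ_i, 2ε²)`
(all coordinates mutually independent) such that for every `s`-sparse `θ`,
`E[(T(y) − ‖θ‖_γ)²] ≤ C ε² s^{2/γ} / log(s²/d)`. -/
theorem dense_zone_upper_bound_norm (γ : ℝ) (hγ : 1 < γ) :
    ∃ C : ℝ, 0 < C ∧
      ∀ d s : ℕ, 1 ≤ s → s ≤ d → 4 * d ≤ s ^ 2 →
        ∀ ε : ℝ, 0 < ε →
          ∃ T : (Fin d → ℝ) × (Fin d → ℝ) → ℝ, Measurable T ∧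
            ∀ θ : Fin d → ℝ, (Finset.univ.filter fun i => θ i ≠ 0).card ≤ s →
              ∫ y, (T y - (∑ i, |θ i| ^ γ) ^ (1 / γ)) ^ 2
                  ∂((Measure.pi fun i : Fin d => gaussianReal (θ i) (2 * ε ^ 2).toNNReal).prod
                    (Measure.pi fun i : Fin d => gaussianReal (θ i) (2 * ε ^ 2).toNNReal))
                ≤ C * ε ^ 2 * (s : ℝ) ^ (2 / γ) / Real.log ((s : ℝ) ^ 2 / d) := by
  obtain ⟨C, hC, h⟩ := exists_norm_estimator hγ
  refine ⟨C, hC, fun d s hs hsd h4 ε hε => ?_⟩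
  obtain ⟨T, hT, hbound⟩ := h d s hs hsd h4 ε hε
  exact ⟨T, hT, fun θ hθ => (hbound θ hθ).2⟩
end
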